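/- arXiv:2009.02125 — 4 statements merged into one kernel-verified Lean document; each statement's English description precedes it below -/
import Mathlib

section
/- Let n be a positive integer and w a permutation in the symmetric group S_n. Then w contains the pattern 321 exactly once and avoids the pattern 3412 if and only if there exist a reduced decomposition w = s_{i_1}⋯s_{i_ℓ} (ℓ = ℓ(w)) and an index q with 1 ≤ q ≤ ℓ−2 such that (i_q, i_{q+1}, i_{q+2}) = (i, i+1, i) for some i, the letter i occurs exactly twice among i_1,…,i_ℓ, and every other letter occurs exactly once. -/
/-- `simpleT n i` is the adjacent transposition `sᵢ = (i, i+1)` (one-indexed values),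
acting on `{1, …, n}` represented (zero-indexed) by `Fin n`.  It is the identity
permutation when `i` is outside the valid range `1 ≤ i ≤ n - 1`. -/
def simpleT (n : ℕ) (i : ℕ) : Equiv.Perm (Fin n) :=
  if h : 1 ≤ i ∧ i < n then Equiv.swap ⟨i - 1, by omega⟩ ⟨i, h.2⟩ else 1

/-- The (Coxeter) length `ℓ(w)`: the minimal number of adjacent transpositions whose
product is `w`. -/
noncomputable def permLen (n : ℕ) (w : Equiv.Perm (Fin n)) : ℕ :=
  sInf {l : ℕ | ∃ word : List ℕ, word.length = l ∧ (word.map (simpleT n)).prod = w}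

/-- `word` is a reduced decomposition of `w`: its product is `w` and its length is `ℓ(w)`. -/
def IsReducedWord (n : ℕ) (word : List ℕ) (w : Equiv.Perm (Fin n)) : Prop :=
  (word.map (simpleT n)).prod = w ∧ word.length = permLen n w

/-- The support of `w`: the set of letters `i` such that `sᵢ` appears in some reduced
decomposition of `w`. -/
def permSupp (n : ℕ) (w : Equiv.Perm (Fin n)) : Set ℕ :=
  {i | ∃ word : List ℕ, IsReducedWord n word w ∧ i ∈ word}

/-- Bruhat order: `v ≤ w` iff some reduced decomposition of `v` is a subword of some
reduced decomposition of `w`. -/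
def bruhatLE (n : ℕ) (v w : Equiv.Perm (Fin n)) : Prop :=
  ∃ wordv wordw : List ℕ, IsReducedWord n wordv v ∧ IsReducedWord n wordw w ∧
    wordv.Sublist wordw

/-- Strict Bruhat order. -/
def bruhatLT (n : ℕ) (v w : Equiv.Perm (Fin n)) : Prop :=
  bruhatLE n v w ∧ v ≠ w

/-- An occurrence of the pattern `p ∈ S_k` in `w ∈ S_n`: a strictly increasing sequence
`j` of indices such that the entries of `w` along `j` are in the same relative order
as the entries of `p`. -/
def IsPatternOcc {n k : ℕ} (w : Equiv.Perm (Fin n)) (p : Equiv.Perm (Fin k))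
    (j : Fin k → Fin n) : Prop :=
  StrictMono j ∧ ∀ a b : Fin k, w (j a) < w (j b) ↔ p a < p b

/-- `w` contains the pattern `p`. -/
def ContainsPattern {n k : ℕ} (w : Equiv.Perm (Fin n)) (p : Equiv.Perm (Fin k)) : Prop :=
  ∃ j : Fin k → Fin n, IsPatternOcc w p j

/-- `w` avoids the pattern `p`. -/
def AvoidsPattern {n k : ℕ} (w : Equiv.Perm (Fin n)) (p : Equiv.Perm (Fin k)) : Prop :=
  ¬ ContainsPattern w p

/-- `w` contains the pattern `p` exactly once. -/
def ContainsPatternOnce {n k : ℕ} (w : Equiv.Perm (Fin n)) (p : Equiv.Perm (Fin k)) : Prop :=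
  ∃! j : Fin k → Fin n, IsPatternOcc w p j

/-- The number of occurrences of the pattern `p` in `w`. -/
noncomputable def numOcc {n k : ℕ} (w : Equiv.Perm (Fin n)) (p : Equiv.Perm (Fin k)) : ℕ :=
  Set.ncard {j : Fin k → Fin n | IsPatternOcc w p j}

/-- The pattern `321` (one-line notation `1↦3, 2↦2, 3↦1`), as a permutation of `Fin 3`. -/
def pattern321 : Equiv.Perm (Fin 3) := Equiv.swap 0 2

/-- The pattern `3412` (one-line notation `1↦3, 2↦4, 3↦1, 4↦2`). -/
def pattern3412 : Equiv.Perm (Fin 4) := Equiv.swap 0 2 * Equiv.swap 1 3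

/-- The pattern `4231` (one-line notation `1↦4, 2↦2, 3↦3, 4↦1`). -/
def pattern4231 : Equiv.Perm (Fin 4) := Equiv.swap 0 3

/-- The pattern `4321` (one-line notation `1↦4, 2↦3, 3↦2, 4↦1`). -/
def pattern4321 : Equiv.Perm (Fin 4) := Equiv.swap 0 3 * Equiv.swap 1 2

/-- The point `(u(1), …, u(n)) ∈ ℝⁿ` attached to a permutation `u` (one-indexed values). -/
def permPoint (n : ℕ) (u : Equiv.Perm (Fin n)) : Fin n → ℝ :=
  fun k => ((u k : ℕ) : ℝ) + 1

/-- The Bruhat interval polytope `Q_{v,w}`: the convex hull of the points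
`(u(1), …, u(n))` for all `u` with `v ≤ u ≤ w` in Bruhat order. -/
noncomputable def BIP (n : ℕ) (v w : Equiv.Perm (Fin n)) : Set (Fin n → ℝ) :=
  convexHull ℝ
    {x | ∃ u : Equiv.Perm (Fin n), bruhatLE n v u ∧ bruhatLE n u w ∧ x = permPoint n u}

/-- A face of a polytope `P`: a convex extreme subset of `P`. -/
def IsFaceOf {E : Type*} [AddCommGroup E] [Module ℝ E] (P F : Set E) : Prop :=
  IsExtreme ℝ P F ∧ Convex ℝ F

/-- Combinatorial equivalence of two polytopes: an inclusion-preserving (in both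
directions) bijection between their face lattices. -/
def CombEquiv {E F : Type*} [AddCommGroup E] [Module ℝ E] [AddCommGroup F] [Module ℝ F]
    (P : Set E) (Q : Set F) : Prop :=
  ∃ e : {A : Set E // IsFaceOf P A} ≃ {B : Set F // IsFaceOf Q B},
    ∀ A B : {A : Set E // IsFaceOf P A}, A.1 ⊆ B.1 ↔ (e A).1 ⊆ (e B).1

/-- The transposition `(i, j)` (one-indexed values, `1 ≤ i < j ≤ n`), acting on
`{1, …, n}` represented by `Fin n`; identity for invalid input. -/
def transpPerm (n i j : ℕ) : Equiv.Perm (Fin n) :=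
  if h : 1 ≤ i ∧ i < j ∧ j ≤ n then Equiv.swap ⟨i - 1, by omega⟩ ⟨j - 1, by omega⟩ else 1

/-- `T̄(u,[v,w])`: the set of transpositions `(i,j)`, `i < j`, with
`u < u·(i,j) ≤ w` and `ℓ(u·(i,j)) = ℓ(u) + 1`. -/
def upperT (n : ℕ) (u v w : Equiv.Perm (Fin n)) : Set (ℕ × ℕ) :=
  {p | 1 ≤ p.1 ∧ p.1 < p.2 ∧ p.2 ≤ n ∧
    bruhatLT n u (u * transpPerm n p.1 p.2) ∧ bruhatLE n (u * transpPerm n p.1 p.2) w ∧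
    permLen n (u * transpPerm n p.1 p.2) = permLen n u + 1}

/-- `T̲(u,[v,w])`: the set of transpositions `(i,j)`, `i < j`, with
`v ≤ u·(i,j) < u` and `ℓ(u·(i,j)) = ℓ(u) - 1`. -/
def lowerT (n : ℕ) (u v w : Equiv.Perm (Fin n)) : Set (ℕ × ℕ) :=
  {p | 1 ≤ p.1 ∧ p.1 < p.2 ∧ p.2 ≤ n ∧
    bruhatLE n v (u * transpPerm n p.1 p.2) ∧ bruhatLT n (u * transpPerm n p.1 p.2) u ∧
    permLen n (u * transpPerm n p.1 p.2) + 1 = permLen n u}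

/-- The permutohedron `Perm₂ ⊂ ℝ³`, a hexagon. -/
noncomputable def Perm2Hex : Set (Fin 3 → ℝ) :=
  convexHull ℝ {x | ∃ σ : Equiv.Perm (Fin 3), x = permPoint 3 σ}

/-- The action of `s_r` on one-indexed letters: swaps `r` and `r + 1`. -/
def srNat (r x : ℕ) : ℕ := if x = r then r + 1 else if x = r + 1 then r else x
namespace Daly
open Equiv

def S (i : ℕ) : Perm ℕ := swap (i - 1) i

def FX (m : ℕ) (w : Perm ℕ) : Prop := ∀ k, m ≤ k → w k = k

def O3 (w : Perm ℕ) (a b c : ℕ) : Prop := a < b ∧ b < c ∧ w c < w b ∧ w b < w a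

def O4 (w : Perm ℕ) (a b c d : ℕ) : Prop :=
  a < b ∧ b < c ∧ c < d ∧ w c < w d ∧ w d < w a ∧ w a < w b

def N3 (w : Perm ℕ) : Prop := ∀ a b c, ¬ O3 w a b c
def N4 (w : Perm ℕ) : Prop := ∀ a b c d, ¬ O4 w a b c d
def U3 (w : Perm ℕ) : Prop :=
  ∃ a b c, O3 w a b c ∧ ∀ a' b' c', O3 w a' b' c' → a' = a ∧ b' = b ∧ c' = c

inductive B : ℕ → Perm ℕ → Prop
  | one : B 0 1
  | skip (m : ℕ) (x : Perm ℕ) : B m x → B (m + 1) x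
  | right (m : ℕ) (x : Perm ℕ) : 1 ≤ m → B m x → B (m + 1) (x * S m)
  | left (m : ℕ) (x : Perm ℕ) : 1 ≤ m → B m x → B (m + 1) (S m * x)

inductive D : ℕ → Perm ℕ → Prop
  | skip (m : ℕ) (x : Perm ℕ) : D m x → D (m + 1) x
  | right (m : ℕ) (x : Perm ℕ) : 1 ≤ m → D m x → D (m + 1) (x * S m)
  | left (m : ℕ) (x : Perm ℕ) : 1 ≤ m → D m x → D (m + 1) (S m * x)
  | tr (m : ℕ) (x : Perm ℕ) : 1 ≤ m → B m x → D (m + 2) (x * swap (m - 1) (m + 1))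
  | tl (m : ℕ) (x : Perm ℕ) : 1 ≤ m → B m x → D (m + 2) (swap (m - 1) (m + 1) * x)

theorem S_inv (i : ℕ) : (S i)⁻¹ = S i := by simp [S]

theorem FX.lt {m : ℕ} {w : Perm ℕ} (h : FX m w) {k : ℕ} (hk : k < m) : w k < m := by
  by_contra h'
  have := h (w k) (by omega)
  have := w.injective this
  omega

theorem FX.inv {m : ℕ} {w : Perm ℕ} (h : FX m w) : FX m w⁻¹ := by
  intro k hk
  rw [Perm.inv_eq_iff_eq]
  exact (h k hk).symm

theorem O3_inv {w : Perm ℕ} {a b c : ℕ} (h : O3 w a b c) : O3 w⁻¹ (w c) (w b) (w a) := by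
  have e : ∀ k, w⁻¹ (w k) = k := fun k => by simp
  simp only [O3, e] at *
  omega

theorem O4_inv {w : Perm ℕ} {a b c d : ℕ} (h : O4 w a b c d) :
    O4 w⁻¹ (w c) (w d) (w a) (w b) := by
  have e : ∀ k, w⁻¹ (w k) = k := fun k => by simp
  simp only [O4, e] at *
  omega

theorem N3.inv {w : Perm ℕ} (h : N3 w) : N3 w⁻¹ := by
  intro a b c hh
  have := O3_inv hh
  rw [inv_inv] at this
  exact h _ _ _ this

theorem N4.inv {w : Perm ℕ} (h : N4 w) : N4 w⁻¹ := by
  intro a b c d hh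
  have := O4_inv hh
  rw [inv_inv] at this
  exact h _ _ _ _ this

theorem U3.inv {w : Perm ℕ} (h : U3 w) : U3 w⁻¹ := by
  obtain ⟨a, b, c, h1, h2⟩ := h
  refine ⟨w c, w b, w a, O3_inv h1, ?_⟩
  intro a' b' c' hh
  have := O3_inv hh
  rw [inv_inv] at this
  obtain ⟨e1, e2, e3⟩ := h2 _ _ _ this
  rw [← e1, ← e2, ← e3]
  simp

theorem B.inv {m : ℕ} {w : Perm ℕ} (h : B m w) : B m w⁻¹ := by
  induction h with
  | one => exact B.one
  | skip m x _ ih => exact B.skip _ _ ih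
  | right m x hm _ ih => rw [mul_inv_rev, S_inv]; exact B.left _ _ hm ih
  | left m x hm _ ih => rw [mul_inv_rev, S_inv]; exact B.right _ _ hm ih

theorem D.inv {m : ℕ} {w : Perm ℕ} (h : D m w) : D m w⁻¹ := by
  induction h with
  | skip m x _ ih => exact D.skip _ _ ih
  | right m x hm _ ih => rw [mul_inv_rev, S_inv]; exact D.left _ _ hm ih
  | left m x hm _ ih => rw [mul_inv_rev, S_inv]; exact D.right _ _ hm ih
  | tr m x hm h => rw [mul_inv_rev, swap_inv]; exact D.tl _ _ hm h.inv
  | tl m x hm h => rw [mul_inv_rev, swap_inv]; exact D.tr _ _ hm h.inv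

theorem S_apply (m k : ℕ) : S m k = if k = m - 1 then m else if k = m then m - 1 else k := by
  simp [S, swap_apply_def]

theorem FX_S (m : ℕ) : FX (m + 1) (S m) := by
  intro k hk
  rw [S_apply]; split_ifs <;> omega

theorem FX.mul {m : ℕ} {w x : Perm ℕ} (h : FX m w) (h' : FX m x) : FX m (w * x) := by
  intro k hk
  rw [Perm.mul_apply, h' k hk, h k hk]

theorem FX.mono {m l : ℕ} {w : Perm ℕ} (h : FX m w) (hl : m ≤ l) : FX l w :=
  fun k hk => h k (by omega)

theorem FX_T (m : ℕ) : FX (m + 2) (swap (m - 1) (m + 1)) := by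
  intro k hk
  rw [swap_apply_def]; split_ifs <;> omega

theorem B.fx {m : ℕ} {w : Perm ℕ} (h : B m w) : FX m w := by
  induction h with
  | one => intro k _; rfl
  | skip m x _ ih => exact ih.mono (by omega)
  | right m x hm _ ih => exact (ih.mono (by omega)).mul (FX_S m)
  | left m x hm _ ih => exact (FX_S m).mul (ih.mono (by omega))

theorem D.fx {m : ℕ} {w : Perm ℕ} (h : D m w) : FX m w := by
  induction h with
  | skip m x _ ih => exact ih.mono (by omega)
  | right m x hm _ ih => exact (ih.mono (by omega)).mul (FX_S m)
  | left m x hm _ ih => exact (FX_S m).mul (ih.mono (by omega))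
  | tr m x hm h => exact (h.fx.mono (by omega)).mul (FX_T m)
  | tl m x hm h => exact (FX_T m).mul (h.fx.mono (by omega))

theorem ev {m : ℕ} {x : Perm ℕ} (hm : 1 ≤ m) (h : FX m x) (k : ℕ) :
    (k < m ∧ x k < m ∨ m ≤ k ∧ x k = k) ∧
    (k + 1 < m ∧ S m k = k ∧ (x * S m) k = x k ∨ k + 1 = m ∧ S m k = m ∧ (x * S m) k = m ∨
      k = m ∧ S m k + 1 = m ∧ (x * S m) k = x (S m k) ∧ x (S m k) < m ∨
      m < k ∧ S m k = k ∧ (x * S m) k = k) := by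
  constructor
  · rcases lt_or_ge k m with h1 | h1
    · exact Or.inl ⟨h1, h.lt h1⟩
    · exact Or.inr ⟨h1, h k h1⟩
  · rw [Perm.mul_apply]
    have := S_apply m k
    rcases lt_trichotomy k m with h1 | h1 | h1
    · by_cases h2 : k + 1 = m
      · rw [if_pos (by omega)] at this
        rw [this, h m le_rfl]; omega
      · rw [if_neg (by omega), if_neg (by omega)] at this
        rw [this]; omega
    · rw [if_neg (by omega), if_pos (by omega)] at this
      have h3 : x (S m k) < m := h.lt (by omega)
      omega
    · rw [if_neg (by omega), if_neg (by omega)] at this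
      rw [this, h k (by omega)]; omega

theorem O3_S1 {m : ℕ} {x : Perm ℕ} (hm : 1 ≤ m) (h : FX m x) {a b c : ℕ}
    (hh : O3 (x * S m) a b c) : O3 x (S m a) (S m b) (S m c) := by
  unfold O3 at *
  have ea := ev hm h a
  have eb := ev hm h b
  have ec := ev hm h c
  have ea : S m a = a ∧ (x * S m) a = x a := by omega
  have eb : S m b = b ∧ (x * S m) b = x b := by omega
  have ec : S m c ≤ c ∧ b < S m c ∧ (x * S m) c = x (S m c) := by
    refine ⟨?_, ?_, rfl⟩ <;> omega
  rw [ea.1, eb.1]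
  omega

theorem O4_S1 {m : ℕ} {x : Perm ℕ} (hm : 1 ≤ m) (h : FX m x) {a b c d : ℕ}
    (hh : O4 (x * S m) a b c d) : O4 x (S m a) (S m b) (S m c) (S m d) := by
  unfold O4 at *
  have ea := ev hm h a
  have eb := ev hm h b
  have ec := ev hm h c
  have ed := ev hm h d
  have ea : S m a = a ∧ (x * S m) a = x a := by omega
  have eb : S m b = b ∧ (x * S m) b = x b := by omega
  have ec : S m c = c ∧ (x * S m) c = x c := by omega
  have ed : S m d ≤ d ∧ c < S m d ∧ (x * S m) d = x (S m d) := by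
    refine ⟨?_, ?_, rfl⟩ <;> omega
  rw [ea.1, eb.1, ec.1]
  omega

theorem SS (m k : ℕ) : S m (S m k) = k := by simp [S]

theorem O3_S2 {m : ℕ} {x : Perm ℕ} (hm : 1 ≤ m) (h : FX m x) {a b c : ℕ}
    (hh : O3 x a b c) : O3 (x * S m) (S m a) (S m b) (S m c) := by
  unfold O3 at *
  simp only [Perm.mul_apply, SS]
  have ea := ev hm h a
  have eb := ev hm h b
  have ec := ev hm h c
  omega

theorem O4_S2 {m : ℕ} {x : Perm ℕ} (hm : 1 ≤ m) (h : FX m x) {a b c d : ℕ}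
    (hh : O4 x a b c d) : O4 (x * S m) (S m a) (S m b) (S m c) (S m d) := by
  unfold O4 at *
  simp only [Perm.mul_apply, SS]
  have ea := ev hm h a
  have eb := ev hm h b
  have ec := ev hm h c
  have ed := ev hm h d
  omega

theorem N3_S {m : ℕ} {x : Perm ℕ} (hm : 1 ≤ m) (h : FX m x) : N3 (x * S m) ↔ N3 x :=
  ⟨fun H _ _ _ hh => H _ _ _ (O3_S2 hm h hh), fun H _ _ _ hh => H _ _ _ (O3_S1 hm h hh)⟩

theorem N4_S {m : ℕ} {x : Perm ℕ} (hm : 1 ≤ m) (h : FX m x) : N4 (x * S m) ↔ N4 x :=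
  ⟨fun H _ _ _ _ hh => H _ _ _ _ (O4_S2 hm h hh), fun H _ _ _ _ hh => H _ _ _ _ (O4_S1 hm h hh)⟩

theorem U3_S {m : ℕ} {x : Perm ℕ} (hm : 1 ≤ m) (h : FX m x) : U3 (x * S m) ↔ U3 x := by
  constructor
  · rintro ⟨a, b, c, h1, h2⟩
    refine ⟨_, _, _, O3_S1 hm h h1, fun a' b' c' hh => ?_⟩
    obtain ⟨e1, e2, e3⟩ := h2 _ _ _ (O3_S2 hm h hh)
    rw [← e1, ← e2, ← e3]
    simp [SS]
  · rintro ⟨a, b, c, h1, h2⟩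
    refine ⟨_, _, _, O3_S2 hm h h1, fun a' b' c' hh => ?_⟩
    obtain ⟨e1, e2, e3⟩ := h2 _ _ _ (O3_S1 hm h hh)
    rw [← e1, ← e2, ← e3]
    simp [SS]

theorem inv_S_mul (m : ℕ) (x : Perm ℕ) : S m * x = (x⁻¹ * S m)⁻¹ := by
  rw [mul_inv_rev, S_inv, inv_inv]

theorem B.av {m : ℕ} {w : Perm ℕ} (h : B m w) : N3 w ∧ N4 w := by
  induction h with
  | one => 
    constructor
    · intro a b c h; simp [O3] at h; omega
    · intro a b c d h; simp [O4] at h; omega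
  | skip m x _ ih => exact ih
  | right m x hm hB ih => exact ⟨(N3_S hm hB.fx).2 ih.1, (N4_S hm hB.fx).2 ih.2⟩
  | left m x hm hB ih =>
    rw [inv_S_mul]
    exact ⟨((N3_S hm hB.inv.fx).2 ih.1.inv).inv, ((N4_S hm hB.inv.fx).2 ih.2.inv).inv⟩

/-- evaluation of `x * swap (m-1) (m+1)` -/
theorem evT {m : ℕ} {x : Perm ℕ} (hm : 1 ≤ m) (h : FX m x) (k : ℕ) :
    (k + 1 < m ∧ (x * swap (m - 1) (m + 1)) k = x k ∧ x k < m ∨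
      k + 1 = m ∧ (x * swap (m - 1) (m + 1)) k = m + 1 ∨
      k = m ∧ (x * swap (m - 1) (m + 1)) k = m ∨
      k = m + 1 ∧ (x * swap (m - 1) (m + 1)) k = x (m - 1) ∧ x (m - 1) < m ∨
      m + 1 < k ∧ (x * swap (m - 1) (m + 1)) k = k) := by
  rw [Perm.mul_apply]
  have := swap_apply_def (m - 1) (m + 1) k
  by_cases h1 : k + 1 < m
  · rw [if_neg (by omega), if_neg (by omega)] at this
    rw [this]
    exact Or.inl ⟨h1, rfl, h.lt (by omega)⟩
  by_cases h2 : k + 1 = m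
  · rw [if_pos (by omega)] at this
    rw [this, h _ (by omega)]; omega
  by_cases h3 : k = m + 1
  · rw [if_neg (by omega), if_pos (by omega)] at this
    have := h.lt (show m - 1 < m by omega)
    simp_all
  · rw [if_neg (by omega), if_neg (by omega)] at this
    rw [this, h _ (by omega)]; omega

theorem T_U3 {m : ℕ} {x : Perm ℕ} (hm : 1 ≤ m) (h : FX m x) (h3 : N3 x) :
    U3 (x * swap (m - 1) (m + 1)) := by
  refine ⟨m - 1, m, m + 1, ?_, ?_⟩
  · have e1 := evT hm h (m - 1)
    have e2 := evT hm h m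
    have e3 := evT hm h (m + 1)
    unfold O3; omega
  · intro a b c hh
    have ea := evT hm h a
    have eb := evT hm h b
    have ec := evT hm h c
    by_contra hne
    unfold O3 at hh
    by_cases hc : c = m + 1
    · subst hc
      apply h3 a b (m - 1)
      unfold O3
      omega
    · apply h3 a b c
      unfold O3
      omega

theorem T_N4 {m : ℕ} {x : Perm ℕ} (hm : 1 ≤ m) (h : FX m x) (h4 : N4 x) :
    N4 (x * swap (m - 1) (m + 1)) := by
  intro a b c d hh
  have ea := evT hm h a
  have eb := evT hm h b
  have ec := evT hm h c
  have ed := evT hm h d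
  unfold O4 at hh
  by_cases hd : d = m + 1
  · subst hd
    apply h4 a b c (m - 1)
    unfold O4
    omega
  · apply h4 a b c d
    unfold O4
    omega

theorem inv_T_mul (m : ℕ) (x : Perm ℕ) : swap (m - 1) (m + 1) * x =
    (x⁻¹ * swap (m - 1) (m + 1))⁻¹ := by
  rw [mul_inv_rev, swap_inv, inv_inv]

theorem D.av {m : ℕ} {w : Perm ℕ} (h : D m w) : U3 w ∧ N4 w := by
  induction h with
  | skip m x _ ih => exact ih
  | right m x hm hB ih => exact ⟨(U3_S hm hB.fx).2 ih.1, (N4_S hm hB.fx).2 ih.2⟩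
  | left m x hm hB ih =>
    rw [inv_S_mul]
    exact ⟨((U3_S hm hB.inv.fx).2 ih.1.inv).inv, ((N4_S hm hB.inv.fx).2 ih.2.inv).inv⟩
  | tr m x hm h => exact ⟨T_U3 hm h.fx h.av.1, T_N4 hm h.fx h.av.2⟩
  | tl m x hm h =>
    rw [inv_T_mul]
    exact ⟨(T_U3 hm h.inv.fx h.inv.av.1).inv, (T_N4 hm h.inv.fx h.inv.av.2).inv⟩

/-- the top of the permutation is adjacent -/
theorem B_top {m : ℕ} {w : Perm ℕ} (hw : FX (m + 1) w) (h3 : N3 w) (h4 : N4 w)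
    (hne : w m ≠ m) : w (m - 1) = m ∨ w m = m - 1 := by
  by_contra! hc
  obtain ⟨p, hp⟩ := w.surjective m
  obtain ⟨t, ht⟩ := w.surjective (m - 1)
  have inj : ∀ a b, w a = w b → a = b := fun a b h => w.injective h
  have l1 := hw.lt (show m < m + 1 by omega)
  have l2 := hw.lt (show m - 1 < m + 1 by omega)
  have hpm : p < m := by
    rcases lt_trichotomy p m with h | h | h
    · exact h
    · subst h; omega
    · have := hw p (by omega); omega
  have hp1 : p ≠ m - 1 := by rintro rfl; omega
  have htm : t < m := by
    rcases lt_trichotomy t m with h | h | h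
    · exact h
    · subst h; omega
    · have := hw t (by omega); omega
  have hpt : p ≠ t := by rintro rfl; omega
  have hr : w (m - 1) ≠ w m := fun h => by have := inj _ _ h; omega
  have a1 := h3 p t m
  have a2 := h3 p (m - 1) m
  have a3 := h4 t p (m - 1) m
  have ht1 : t = m - 1 → w (m - 1) = m - 1 := by rintro rfl; omega
  unfold O3 at *
  unfold O4 at *
  omega

theorem B_of {m : ℕ} : ∀ {w : Perm ℕ}, FX m w → N3 w → N4 w → B m w := by
  induction m with
  | zero =>
    intro w hw _ _
    have : w = 1 := Equiv.ext fun k => hw k (by omega)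
    rw [this]; exact B.one
  | succ m ih =>
    have key : ∀ w : Perm ℕ, FX (m + 1) w → N3 w → N4 w → 1 ≤ m → w (m - 1) = m →
        B (m + 1) w := by
      intro w hw h3 h4 hm he
      have e : w = (w * S m) * S m := by ext k; simp [SS]
      have hx : FX m (w * S m) := by
        intro k hk
        rw [Perm.mul_apply, S_apply]
        split_ifs with h1 h2
        · omega
        · omega
        · exact hw k (by omega)
      rw [e] at h3 h4 ⊢
      exact B.right _ _ hm (ih hx ((N3_S hm hx).1 h3) ((N4_S hm hx).1 h4))
    intro w hw h3 h4
    by_cases hne : w m = m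
    · refine B.skip _ _ (ih ?_ h3 h4)
      intro k hk
      rcases hk.eq_or_lt with rfl | h
      · exact hne
      · exact hw k h
    · have hm : 1 ≤ m := by
        have := hw.lt (show m < m + 1 by omega)
        omega
      rcases B_top hw h3 h4 hne with h | h
      · exact key w hw h3 h4 hm h
      · have := (key w⁻¹ hw.inv h3.inv h4.inv hm (by rw [← h]; simp)).inv
        rwa [inv_inv] at this

theorem D_top {m : ℕ} {w : Perm ℕ} (hw : FX (m + 1) w) (h3 : U3 w) (h4 : N4 w)
    (hne : w m ≠ m) : w (m - 1) = m ∨ w m = m - 1 ∨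
      (2 ≤ m ∧ w (m - 1) = m - 1 ∧ (w (m - 2) = m ∨ w m = m - 2)) := by
  by_contra! hc
  obtain ⟨A, B, C, -, h3⟩ := h3
  obtain ⟨p, hp⟩ := w.surjective m
  obtain ⟨t, ht⟩ := w.surjective (m - 1)
  obtain ⟨t', ht'⟩ := w.surjective (m - 2)
  have inj : ∀ a b, w a = w b → a = b := fun a b h => w.injective h
  have l1 := hw.lt (show m < m + 1 by omega)
  have l2 := hw.lt (show m - 1 < m + 1 by omega)
  have l3 := hw.lt (show m - 2 < m + 1 by omega)
  have hpm : p < m := by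
    rcases lt_trichotomy p m with h | h | h
    · exact h
    · subst h; omega
    · have := hw p (by omega); omega
  have hp1 : p ≠ m - 1 := by rintro rfl; omega
  have htm : t < m := by
    rcases lt_trichotomy t m with h | h | h
    · exact h
    · subst h; omega
    · have := hw t (by omega); omega
  have hpt : p ≠ t := by rintro rfl; omega
  have hr : w (m - 1) ≠ w m := fun h => by have := inj _ _ h; omega
  have hmid : w (m - 1) = m - 1 := by
    by_contra hcon
    have ht1 : t ≠ m - 1 := by rintro rfl; omega
    rcases lt_or_gt_of_ne hpt with hlt | hlt
    · have a1 := h3 p t m ⟨hlt, htm, by omega, by omega⟩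
      rcases lt_or_gt_of_ne hr with hq | hq
      · have a2 := h3 p t (m - 1) ⟨hlt, by omega, by omega, by omega⟩
        omega
      · have a2 := h3 p (m - 1) m ⟨by omega, by omega, by omega, by omega⟩
        omega
    · rcases lt_or_gt_of_ne hr with hq | hq
      · exact h4 t p (m - 1) m ⟨by omega, by omega, by omega, by omega, by omega, by omega⟩
      · have a1 := h3 p (m - 1) m ⟨by omega, by omega, by omega, by omega⟩
        have a2 := h3 t (m - 1) m ⟨by omega, by omega, by omega, by omega⟩
        omega
  have h2 : 2 ≤ m := by omega
  have hc := hc.2.2 h2 hmid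
  have hp2 : p ≠ m - 2 := by rintro rfl; omega
  have q1 : t' ≠ m := by rintro rfl; omega
  have q2 : t' ≠ m - 1 := by rintro rfl; omega
  have q3 : t' ≠ p := by rintro rfl; omega
  have htm' : t' < m := by
    rcases lt_trichotomy t' m with h | h | h
    · exact h
    · subst h; omega
    · have := hw t' (by omega); omega
  have hr' : w (m - 2) ≠ w m := fun h => by have := inj _ _ h; omega
  have hr'' : w (m - 2) ≠ w (m - 1) := fun h => by have := inj _ _ h; omega
  have a1 := h3 p (m - 1) m ⟨by omega, by omega, by omega, by omega⟩
  have r1 : w (m - 2) < w m := by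
    by_contra hcon
    have a2 := h3 p (m - 2) m ⟨by omega, by omega, by omega, by omega⟩
    omega
  have r2 : t' < p := by
    by_contra hcon
    have a2 := h3 p t' m ⟨by omega, by omega, by omega, by omega⟩
    omega
  exact h4 t' p (m - 2) m ⟨by omega, by omega, by omega, by omega, by omega, by omega⟩

theorem T_N3_rev {k : ℕ} {x : Perm ℕ} (hk : 1 ≤ k) (hx : FX k x)
    (h3 : U3 (x * swap (k - 1) (k + 1))) : N3 x := by
  obtain ⟨A, B, C, -, h3⟩ := h3
  have e1 := evT hk hx (k - 1)
  have e2 := evT hk hx k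
  have e3 := evT hk hx (k + 1)
  have u := h3 (k - 1) k (k + 1) ⟨by omega, by omega, by omega, by omega⟩
  clear e1 e2
  intro a b c hh
  unfold O3 at hh
  have hc : c < k := by
    have fa := (ev hk hx a).1
    have fc := (ev hk hx c).1
    omega
  have ea := evT hk hx a
  have eb := evT hk hx b
  have ea : (x * swap (k - 1) (k + 1)) a = x a := by omega
  have eb : (x * swap (k - 1) (k + 1)) b = x b := by omega
  by_cases hc : c = k - 1
  · subst hc
    have := h3 a b (k + 1) ⟨by omega, by omega, by omega, by omega⟩
    omega
  · have ec := evT hk hx c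
    have := h3 a b c ⟨by omega, by omega, by omega, by omega⟩
    omega

theorem T_N4_rev {k : ℕ} {x : Perm ℕ} (hk : 1 ≤ k) (hx : FX k x)
    (h4 : N4 (x * swap (k - 1) (k + 1))) : N4 x := by
  have e3 := evT hk hx (k + 1)
  intro a b c d hh
  unfold O4 at hh
  have hc : d < k := by
    have fa := (ev hk hx a).1
    have fc := (ev hk hx d).1
    omega
  have ea := evT hk hx a
  have eb := evT hk hx b
  have ec := evT hk hx c
  have ea : (x * swap (k - 1) (k + 1)) a = x a := by omega
  have eb : (x * swap (k - 1) (k + 1)) b = x b := by omega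
  have ec : (x * swap (k - 1) (k + 1)) c = x c := by omega
  by_cases hc : d = k - 1
  · subst hc
    exact h4 a b c (k + 1) ⟨by omega, by omega, by omega, by omega, by omega, by omega⟩
  · have ed := evT hk hx d
    exact h4 a b c d ⟨by omega, by omega, by omega, by omega, by omega, by omega⟩

theorem D_of {m : ℕ} : ∀ {w : Perm ℕ}, FX m w → U3 w → N4 w → D m w := by
  induction m with
  | zero =>
    intro w hw h _
    obtain ⟨a, b, c, h, -⟩ := h
    have h1 := hw a (by omega)
    have h2 := hw b (by omega)
    have h3 := hw c (by omega)
    unfold O3 at h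
    omega
  | succ m ih =>
    have key : ∀ w : Perm ℕ, FX (m + 1) w → U3 w → N4 w → 1 ≤ m → w (m - 1) = m →
        D (m + 1) w := by
      intro w hw h3 h4 hm he
      have e : w = (w * S m) * S m := by ext k; simp [SS]
      have hx : FX m (w * S m) := by
        intro k hk
        rw [Perm.mul_apply, S_apply]
        split_ifs with h1 h2
        · omega
        · omega
        · exact hw k (by omega)
      rw [e] at h3 h4 ⊢
      exact D.right _ _ hm (ih hx ((U3_S hm hx).1 h3) ((N4_S hm hx).1 h4))
    have key2 : ∀ w : Perm ℕ, FX (m + 1) w → U3 w → N4 w → 2 ≤ m → w (m - 1) = m - 1 →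
        w (m - 2) = m → D (m + 1) w := by
      intro w hw h3 h4 hm he1 he2
      obtain ⟨k, rfl⟩ : ∃ k, m = k + 1 := ⟨m - 1, by omega⟩
      have hk : 1 ≤ k := by omega
      have he1 : w k = k := by simpa using he1
      have he2 : w (k - 1) = k + 1 := he2
      obtain ⟨x, hxd⟩ : ∃ x, x = w * swap (k - 1) (k + 1) := ⟨_, rfl⟩
      have e : w = x * swap (k - 1) (k + 1) := by
        rw [hxd]; ext k; simp
      have hx : FX k x := by
        intro j hj
        rw [hxd, Perm.mul_apply, swap_apply_def]
        split_ifs with h1 h2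
        · omega
        · omega
        · rcases hj.eq_or_lt with rfl | h
          · exact he1
          · exact hw j (by omega)
      rw [e] at h3 h4 ⊢
      exact D.tr _ _ hk (B_of hx (T_N3_rev hk hx h3) (T_N4_rev hk hx h4))
    intro w hw h3 h4
    by_cases hne : w m = m
    · refine D.skip _ _ (ih ?_ h3 h4)
      intro k hk
      rcases hk.eq_or_lt with rfl | h
      · exact hne
      · exact hw k h
    · have hm : 1 ≤ m := by
        have := hw.lt (show m < m + 1 by omega)
        omega
      rcases D_top hw h3 h4 hne with h | h | ⟨h2, h, h' | h'⟩
      · exact key w hw h3 h4 hm h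
      · have := (key w⁻¹ hw.inv h3.inv h4.inv hm (by rw [← h]; simp)).inv
        rwa [inv_inv] at this
      · exact key2 w hw h3 h4 h2 h h'
      · have := (key2 w⁻¹ hw.inv h3.inv h4.inv h2 (by rw [Perm.inv_eq_iff_eq]; exact h.symm)
          (by rw [← h']; simp)).inv
        rwa [inv_inv] at this

def P (l : List ℕ) : Perm ℕ := (l.map S).prod

theorem P_nil : P [] = 1 := rfl
theorem P_cons (a : ℕ) (l : List ℕ) : P (a :: l) = S a * P l := by simp [P]
theorem P_app (l l' : List ℕ) : P (l ++ l') = P l * P l' := by simp [P]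

def OK (m : ℕ) (l : List ℕ) : Prop := ∀ k ∈ l, 1 ≤ k ∧ k < m

theorem OK.fx {m : ℕ} {l : List ℕ} (h : OK m l) : FX m (P l) := by
  induction l with
  | nil => intro k _; rfl
  | cons a l ih =>
    rw [P_cons]
    have := h a (by simp)
    exact ((FX_S a).mono (by omega)).mul (ih fun k hk => h k (by simp [hk]))

theorem comm_swap {m a b : ℕ} {x : Perm ℕ} (h : FX m x) (ha : m ≤ a) (hb : m ≤ b) :
    swap a b * x = x * swap a b := by
  rw [mul_swap_eq_swap_mul, h a ha, h b hb]

theorem core (i : ℕ) (hi : 1 ≤ i) : S i * (S (i + 1) * S i) = swap (i - 1) (i + 1) := by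
  ext k
  simp only [Perm.mul_apply, S_apply, swap_apply_def]
  split_ifs <;> omega

theorem B.word {m : ℕ} {w : Perm ℕ} (h : B m w) : ∃ l : List ℕ, l.Nodup ∧ OK m l ∧ P l = w := by
  induction h with
  | one => exact ⟨[], by simp, by simp [OK], rfl⟩
  | skip m x _ ih =>
    obtain ⟨l, h1, h2, h3⟩ := ih
    exact ⟨l, h1, fun k hk => ⟨(h2 k hk).1, by have := (h2 k hk).2; omega⟩, h3⟩
  | right m x hm _ ih =>
    obtain ⟨l, h1, h2, h3⟩ := ih
    refine ⟨l ++ [m], ?_, ?_, ?_⟩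
    · rw [List.nodup_append]
      refine ⟨h1, by simp, ?_⟩
      intro a ha b hb
      have := h2 a ha
      simp at hb
      omega
    · intro k hk
      simp at hk
      rcases hk with hk | hk
      · have := h2 k hk; omega
      · omega
    · rw [P_app, h3, P_cons, P_nil, mul_one]
  | left m x hm _ ih =>
    obtain ⟨l, h1, h2, h3⟩ := ih
    refine ⟨m :: l, ?_, ?_, ?_⟩
    · rw [List.nodup_cons]
      exact ⟨fun hh => by have := h2 m hh; omega, h1⟩
    · intro k hk
      simp at hk
      rcases hk with hk | hk
      · omega
      · have := h2 k hk; omega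
    · rw [P_cons, h3]

def DW (m : ℕ) (a b : List ℕ) (i : ℕ) : Prop :=
  (a ++ b).Nodup ∧ i ∉ a ++ b ∧ i + 1 ∉ a ++ b ∧ OK m (a ++ b) ∧ 1 ≤ i ∧ i + 1 < m

theorem P_dw {a b : List ℕ} {i : ℕ} (hi : 1 ≤ i) :
    P (a ++ [i, i + 1, i] ++ b) = P a * swap (i - 1) (i + 1) * P b := by
  rw [P_app, P_app, P_cons, P_cons, P_cons, P_nil, mul_one, core i hi]

theorem D.word {m : ℕ} {w : Perm ℕ} (h : D m w) : ∃ a b i, DW m a b i ∧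
    P a * swap (i - 1) (i + 1) * P b = w := by
  induction h with
  | skip m x _ ih =>
    obtain ⟨a, b, i, ⟨h1, h2, h3, h4, h5, h6⟩, h⟩ := ih
    exact ⟨a, b, i, ⟨h1, h2, h3, fun k hk => by have := h4 k hk; omega, h5, by omega⟩, h⟩
  | right m x hm _ ih =>
    obtain ⟨a, b, i, ⟨h1, h2, h3, h4, h5, h6⟩, h⟩ := ih
    refine ⟨a, b ++ [m], i, ⟨?_, ?_, ?_, ?_, h5, by omega⟩, ?_⟩
    · rw [← List.append_assoc, List.nodup_append]
      refine ⟨h1, by simp, ?_⟩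
      intro a ha b hb
      have := h4 a ha
      simp at hb
      omega
    · rw [← List.append_assoc, List.mem_append]; rintro (hh | hh)
      · exact h2 hh
      · simp at hh; omega
    · rw [← List.append_assoc, List.mem_append]; rintro (hh | hh)
      · exact h3 hh
      · simp at hh; omega
    · intro k hk
      rw [← List.append_assoc, List.mem_append] at hk
      rcases hk with hk | hk
      · have := h4 k hk; omega
      · simp at hk; omega
    · rw [P_app, P_cons, P_nil, mul_one, ← h]; group
  | left m x hm _ ih =>
    obtain ⟨a, b, i, ⟨h1, h2, h3, h4, h5, h6⟩, h⟩ := ih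
    refine ⟨m :: a, b, i, ⟨?_, ?_, ?_, ?_, h5, by omega⟩, ?_⟩
    · rw [List.cons_append, List.nodup_cons]
      exact ⟨fun hh => by have := h4 m hh; omega, h1⟩
    · rw [List.cons_append, List.mem_cons]; rintro (hh | hh)
      · omega
      · exact h2 hh
    · rw [List.cons_append, List.mem_cons]; rintro (hh | hh)
      · omega
      · exact h3 hh
    · intro k hk
      rw [List.cons_append, List.mem_cons] at hk
      rcases hk with hk | hk
      · omega
      · have := h4 k hk; omega
    · rw [P_cons, ← h]; group
  | tr m x hm hB =>
    obtain ⟨l, h1, h2, h3⟩ := hB.word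
    refine ⟨l, [], m, ⟨by simpa using h1, ?_, ?_, ?_, hm, by omega⟩, ?_⟩
    · intro hh; have := h2 m (by simpa using hh); omega
    · intro hh; have := h2 (m + 1) (by simpa using hh); omega
    · intro k hk; have := h2 k (by simpa using hk); omega
    · rw [h3, P_nil, mul_one]
  | tl m x hm hB =>
    obtain ⟨l, h1, h2, h3⟩ := hB.word
    refine ⟨[], l, m, ⟨by simpa using h1, ?_, ?_, ?_, hm, by omega⟩, ?_⟩
    · intro hh; have := h2 m (by simpa using hh); omega
    · intro hh; have := h2 (m + 1) (by simpa using hh); omega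
    · intro k hk; have := h2 k (by simpa using hk); omega
    · rw [h3, P_nil, one_mul]

theorem OK.pred {m : ℕ} {l : List ℕ} (h : OK (m + 1) l) (h' : m ∉ l) : OK m l := by
  intro k hk
  have := h k hk
  have : k ≠ m := by rintro rfl; exact h' hk
  omega

theorem OK.pred' {m : ℕ} {l : List ℕ} (h : OK m l) (h' : m - 1 ∉ l) : OK (m - 1) l := by
  intro k hk
  have := h k hk
  have : k ≠ m - 1 := by rintro rfl; exact h' hk
  omega

theorem B_of_word {m : ℕ} : ∀ {l : List ℕ}, l.Nodup → OK m l → B m (P l) := by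
  induction m with
  | zero =>
    intro l _ h
    have : l = [] := List.eq_nil_iff_forall_not_mem.2 fun k hk => by have := h k hk; omega
    subst this; exact B.one
  | succ m ih =>
    intro l hl hok
    by_cases hm : m ∈ l
    · have hm1 := (hok m hm).1
      obtain ⟨u, v, rfl⟩ := List.mem_iff_append.1 hm
      rw [List.nodup_middle, List.nodup_cons] at hl
      obtain ⟨hn, hl⟩ := hl
      have ok' : OK m (u ++ v) := by
        refine OK.pred (fun k hk => hok k ?_) hn
        simp at hk ⊢; tauto
      have oku : OK m u := fun k hk => ok' k (by simp [hk])
      have okv : OK m v := fun k hk => ok' k (by simp [hk])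
      have hB := ih hl ok'
      rw [P_app] at hB
      rw [P_app, P_cons]
      by_cases hv : m - 1 ∈ v
      · have hu : m - 1 ∉ u := fun hu => (List.nodup_append.1 hl).2.2 _ hu _ hv rfl
        have := comm_swap (oku.pred' hu).fx le_rfl (show m - 1 ≤ m by omega)
        have e : P u * (S m * P v) = S m * (P u * P v) := by
          rw [← mul_assoc, ← mul_assoc]; unfold S at *; rw [this]
        rw [e]; exact B.left _ _ hm1 hB
      · have := comm_swap (okv.pred' hv).fx le_rfl (show m - 1 ≤ m by omega)
        have e : P u * (S m * P v) = (P u * P v) * S m := by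
          rw [mul_assoc]; unfold S at *; rw [this]
        rw [e]; exact B.right _ _ hm1 hB
    · exact B.skip _ _ (ih hl (hok.pred hm))

theorem D_of_word {m : ℕ} : ∀ {a b : List ℕ} {i : ℕ}, DW m a b i →
    D m (P a * swap (i - 1) (i + 1) * P b) := by
  induction m with
  | zero => intro a b i h; have := h.2.2.2.2.2; omega
  | succ m ih =>
    rintro a b i ⟨h1, h2, h3, h4, h5, h6⟩
    by_cases him : i + 1 = m
    · subst him
      have ok1 : OK i (a ++ b) := (h4.pred h3).pred h2
      have oka : OK i a := fun k hk => ok1 k (by simp [hk])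
      have okb : OK i b := fun k hk => ok1 k (by simp [hk])
      have hB := B_of_word h1 ok1
      rw [P_app] at hB
      by_cases hv : i - 1 ∈ b
      · have hu : i - 1 ∉ a := fun hu => (List.nodup_append.1 h1).2.2 _ hu _ hv rfl
        have := comm_swap (oka.pred' hu).fx le_rfl (show i - 1 ≤ i + 1 by omega)
        rw [← this, mul_assoc]
        exact D.tl _ _ h5 hB
      · have := comm_swap (okb.pred' hv).fx le_rfl (show i - 1 ≤ i + 1 by omega)
        rw [mul_assoc, this, ← mul_assoc]
        exact D.tr _ _ h5 hB
    · by_cases hm : m ∈ a ++ b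
      · have hm1 := (h4 m hm).1
        rw [List.mem_append] at hm
        -- a general commutation principle
        have cm : ∀ l : List ℕ, OK m l → m - 1 ∉ l → S m * P l = P l * S m := fun l hl hn =>
          comm_swap (hl.pred' hn).fx le_rfl (show m - 1 ≤ m by omega)
        have ct : i + 1 ≠ m - 1 → S m * swap (i - 1) (i + 1) = swap (i - 1) (i + 1) * S m := by
          intro hne
          refine comm_swap (m := m - 1) ?_ le_rfl (by omega)
          exact (FX_T i).mono (by omega)
        rcases hm with hm | hm
        · obtain ⟨u, v, rfl⟩ := List.mem_iff_append.1 hm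
          rw [List.append_assoc, List.cons_append, List.nodup_middle, List.nodup_cons,
            ← List.append_assoc] at h1
          obtain ⟨hn, hl⟩ := h1
          have sub : ∀ k, k ∈ u ++ v ++ b → k ∈ u ++ m :: v ++ b := by
            intro k hk; simp at hk ⊢; tauto
          have ok' : OK m (u ++ v ++ b) := OK.pred (fun k hk => h4 k (sub k hk)) hn
          have hD := @ih (u ++ v) b i ⟨hl, fun h => h2 (sub _ h), fun h => h3 (sub _ h), ok', h5,
            by omega⟩
          have oku : OK m u := fun k hk => ok' k (by simp [hk])
          have okv : OK m v := fun k hk => ok' k (by simp [hk])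
          have okb : OK m b := fun k hk => ok' k (by simp [hk])
          rw [P_app] at hD
          rw [P_app, P_cons]
          by_cases hu : m - 1 ∈ u
          · have hvb : m - 1 ∉ v ++ b := by
              rw [List.append_assoc] at hl
              exact fun hv => (List.nodup_append.1 hl).2.2 _ hu _ hv rfl
            have hne : i + 1 ≠ m - 1 := by
              intro h; apply h3; rw [h]; simp [hu]
            have e : P u * (S m * P v) * swap (i - 1) (i + 1) * P b =
                (P u * P v * swap (i - 1) (i + 1) * P b) * S m := by
              rw [cm v okv (fun h => hvb (by simp [h]))]
              simp only [mul_assoc]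
              rw [← cm b okb (fun h => hvb (by simp [h])), ← mul_assoc (S m), ct hne]
              simp only [mul_assoc]
            rw [e]; exact D.right _ _ hm1 hD
          · have e : P u * (S m * P v) * swap (i - 1) (i + 1) * P b =
                S m * (P u * P v * swap (i - 1) (i + 1) * P b) := by
              simp only [← mul_assoc]
              rw [cm u oku hu]
            rw [e]; exact D.left _ _ hm1 hD
        · obtain ⟨u, v, rfl⟩ := List.mem_iff_append.1 hm
          rw [← List.append_assoc, List.nodup_middle, List.nodup_cons,
            List.append_assoc] at h1
          obtain ⟨hn, hl⟩ := h1
          have sub : ∀ k, k ∈ a ++ (u ++ v) → k ∈ a ++ (u ++ m :: v) := by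
            intro k hk; simp at hk ⊢; tauto
          have ok' : OK m (a ++ (u ++ v)) := OK.pred (fun k hk => h4 k (sub k hk)) hn
          have hD := @ih a (u ++ v) i ⟨hl, fun h => h2 (sub _ h), fun h => h3 (sub _ h), ok', h5,
            by omega⟩
          have oku : OK m u := fun k hk => ok' k (by simp [hk])
          have okv : OK m v := fun k hk => ok' k (by simp [hk])
          have oka : OK m a := fun k hk => ok' k (by simp [hk])
          rw [P_app] at hD
          rw [P_app, P_cons]
          by_cases hv : m - 1 ∈ v
          · have hvb : m - 1 ∉ a ++ u := by
              rw [← List.append_assoc] at hl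
              exact fun hu => (List.nodup_append.1 hl).2.2 _ hu _ hv rfl
            have hne : i + 1 ≠ m - 1 := by
              intro h; apply h3; rw [h]; simp [hv]
            have e : P a * swap (i - 1) (i + 1) * (P u * (S m * P v)) =
                S m * (P a * swap (i - 1) (i + 1) * (P u * P v)) := by
              simp only [← mul_assoc]
              rw [cm a oka (fun h => hvb (by simp [h])), mul_assoc (P a) (S m), ct hne,
                ← mul_assoc, mul_assoc _ (S m) (P u), cm u oku (fun h => hvb (by simp [h]))]
              simp only [mul_assoc]
            rw [e]; exact D.left _ _ hm1 hD
          · have e : P a * swap (i - 1) (i + 1) * (P u * (S m * P v)) =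
                (P a * swap (i - 1) (i + 1) * (P u * P v)) * S m := by
              rw [cm v okv hv]
              simp only [mul_assoc]
            rw [e]; exact D.right _ _ hm1 hD
      · exact D.skip _ _ (ih ⟨h1, h2, h3, h4.pred hm, h5, by omega⟩)

def F (n : ℕ) : Perm (Fin n) →* Perm ℕ := Perm.extendDomainHom Fin.equivSubtype

theorem F_inj (n : ℕ) : Function.Injective (F n) := Perm.extendDomainHom_injective _

theorem F_apply {n : ℕ} (w : Perm (Fin n)) (k : Fin n) : F n w k = w k :=
  Perm.extendDomain_apply_image w Fin.equivSubtype k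

theorem F_fx {n : ℕ} (w : Perm (Fin n)) : FX n (F n w) := fun k hk =>
  Perm.extendDomain_apply_not_subtype w Fin.equivSubtype (by omega)

theorem F_S {n i : ℕ} (h1 : 1 ≤ i) (h2 : i < n) : F n (simpleT n i) = S i := by
  ext k
  rcases lt_or_ge k n with hk | hk
  · have := F_apply (simpleT n i) ⟨k, hk⟩
    simp only at this
    rw [this, S_apply, simpleT, dif_pos ⟨h1, h2⟩, swap_apply_def]
    simp only [Fin.ext_iff]
    split_ifs <;> rfl
  · rw [F_fx _ k hk, S_apply]
    split_ifs <;> omega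

def good (n : ℕ) (l : List ℕ) : List ℕ := l.filter fun k => 1 ≤ k ∧ k < n

theorem good_ok (n : ℕ) (l : List ℕ) : OK n (good n l) := by
  intro k hk
  simpa using (List.mem_filter.1 hk).2

theorem good_len (n : ℕ) (l : List ℕ) : (good n l).length ≤ l.length := List.length_filter_le _ _

theorem good_prod (n : ℕ) (l : List ℕ) :
    ((good n l).map (simpleT n)).prod = (l.map (simpleT n)).prod := by
  induction l with
  | nil => rfl
  | cons a l ih =>
    unfold good at *
    by_cases h : 1 ≤ a ∧ a < n
    · rw [List.filter_cons_of_pos (by simpa using h)]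
      simp only [List.map_cons, List.prod_cons, ih]
    · rw [List.filter_cons_of_neg (by simpa using h)]
      simp only [List.map_cons, List.prod_cons, ih]
      rw [simpleT, dif_neg h, one_mul]

theorem F_prod {n : ℕ} {l : List ℕ} (h : OK n l) : F n ((l.map (simpleT n)).prod) = P l := by
  induction l with
  | nil => simp [P]
  | cons a l ih =>
    have := h a (by simp)
    rw [P_cons, List.map_cons, List.prod_cons, map_mul, F_S this.1 this.2,
      ih fun k hk => h k (by simp [hk])]

theorem sgn {n : ℕ} {l : List ℕ} (h : OK n l) :
    Perm.sign ((l.map (simpleT n)).prod) = (-1) ^ l.length := by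
  induction l with
  | nil => simp
  | cons a l ih =>
    have h1 := h a (by simp)
    have : Perm.sign (simpleT n a) = -1 := by
      rw [simpleT, dif_pos h1, Perm.sign_swap]
      intro hh
      simp [Fin.ext_iff] at hh
      omega
    rw [List.map_cons, List.prod_cons, map_mul, this, ih fun k hk => h k (by simp [hk]),
      List.length_cons, pow_succ, mul_comm]

def Pres (k : ℕ) : Subgroup (Perm ℕ) where
  carrier := {g | ∀ x, g x < k ↔ x < k}
  one_mem' := fun x => Iff.rfl
  mul_mem' := fun {a b} ha hb x => by rw [Perm.mul_apply, ha, hb]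
  inv_mem' := fun {a} ha x => by
    have := ha (a⁻¹ x)
    simpa using this.symm

theorem mem_Pres {k : ℕ} {l : List ℕ} (h : k ∉ l) : P l ∈ Pres k := by
  induction l with
  | nil => exact (Pres k).one_mem
  | cons a l ih =>
    rw [List.mem_cons, not_or] at h
    rw [P_cons]
    refine (Pres k).mul_mem ?_ (ih h.2)
    intro x
    have := h.1
    rw [S_apply]
    split_ifs <;> omega

theorem S_not {k : ℕ} (hk : 1 ≤ k) : S k ∉ Pres k := by
  intro h
  have := h (k - 1)
  rw [S_apply, if_pos rfl] at this
  omega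

theorem T_not {k : ℕ} (hk : 1 ≤ k) : swap (k - 1) (k + 1) ∉ Pres k := by
  intro h
  have := h (k - 1)
  rw [swap_apply_left] at this
  omega

theorem T_not' {k : ℕ} (hk : 1 ≤ k) : swap (k - 1) (k + 1) ∉ Pres (k + 1) := by
  intro h
  have := h (k - 1)
  rw [swap_apply_left] at this
  omega

theorem mid_not {H : Subgroup (Perm ℕ)} {a b c : Perm ℕ} (ha : a ∈ H) (hc : c ∈ H) (hb : b ∉ H) :
    a * b * c ∉ H := by
  rwa [H.mul_mem_cancel_right hc, H.mul_mem_cancel_left ha]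

theorem word_not {m : ℕ} {a b : List ℕ} {i : ℕ} (h : DW m a b i) {k : ℕ}
    (hk : k ∈ i :: (i + 1) :: (a ++ b)) : P a * swap (i - 1) (i + 1) * P b ∉ Pres k := by
  obtain ⟨h1, h2, h3, h4, h5, h6⟩ := h
  rw [List.mem_append, not_or] at h2 h3
  rw [List.mem_cons, List.mem_cons, List.mem_append] at hk
  by_cases e1 : k = i
  · subst e1
    exact mid_not (mem_Pres h2.1) (mem_Pres h2.2) (T_not h5)
  by_cases e2 : k = i + 1
  · subst e2
    exact mid_not (mem_Pres h3.1) (mem_Pres h3.2) (T_not' h5)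
  have hT : swap (i - 1) (i + 1) ∈ Pres k := by
    rw [← core i h5]
    have := @mem_Pres k [i, i + 1, i] (by simp; omega)
    simpa [P] using this
  have hk' : k ∈ a ∨ k ∈ b := by tauto
  have hk1 : 1 ≤ k := (h4 k (List.mem_append.2 hk')).1
  rcases hk' with hk | hk
  · obtain ⟨u, v, rfl⟩ := List.mem_iff_append.1 hk
    rw [List.append_assoc, List.cons_append, List.nodup_middle, List.nodup_cons] at h1
    have h1 := h1.1
    simp only [List.mem_append, not_or] at h1
    rw [P_app, P_cons]
    have : P u * (S k * P v) * swap (i - 1) (i + 1) * P b =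
      P u * S k * (P v * swap (i - 1) (i + 1) * P b) := by simp only [mul_assoc]
    rw [this]
    exact mid_not (mem_Pres h1.1) ((Pres k).mul_mem ((Pres k).mul_mem (mem_Pres h1.2.1) hT)
      (mem_Pres h1.2.2)) (S_not hk1)
  · obtain ⟨u, v, rfl⟩ := List.mem_iff_append.1 hk
    rw [← List.append_assoc, List.nodup_middle, List.nodup_cons] at h1
    have h1 := h1.1
    simp only [List.mem_append, not_or] at h1
    rw [P_app, P_cons]
    have : P a * swap (i - 1) (i + 1) * (P u * (S k * P v)) =
      P a * swap (i - 1) (i + 1) * P u * S k * P v := by simp only [mul_assoc]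
    rw [this]
    exact mid_not ((Pres k).mul_mem ((Pres k).mul_mem (mem_Pres h1.1.1) hT)
      (mem_Pres h1.1.2)) (mem_Pres h1.2) (S_not hk1)

theorem DW.ok {n : ℕ} {a b : List ℕ} {i : ℕ} (h : DW n a b i) : OK n (a ++ [i, i + 1, i] ++ b) := by
  obtain ⟨h1, h2, h3, h4, h5, h6⟩ := h
  intro k hk
  simp only [List.mem_append, List.mem_cons, List.not_mem_nil, or_false] at hk
  have := h4 k
  rw [List.mem_append] at this
  rcases hk with (hk | hk | hk | hk) | hk
  · exact this (Or.inl hk)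
  · omega
  · omega
  · omega
  · exact this (Or.inr hk)

theorem lower {n : ℕ} {a b : List ℕ} {i : ℕ} (h : DW n a b i) {l : List ℕ}
    (he : (l.map (simpleT n)).prod = ((a ++ [i, i + 1, i] ++ b).map (simpleT n)).prod) :
    (a ++ [i, i + 1, i] ++ b).length ≤ l.length := by
  refine le_trans ?_ (good_len n l)
  rw [← good_prod] at he
  have hg := good_ok n l
  generalize good n l = l at he hg
  have e1 := congrArg Perm.sign he
  rw [sgn hg, sgn h.ok] at e1
  have e2 := congrArg (F n) he
  rw [F_prod hg, F_prod h.ok, P_dw h.2.2.2.2.1] at e2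
  have hsub : (i :: (i + 1) :: (a ++ b)).toFinset ⊆ l.toFinset := by
    intro k hk
    rw [List.mem_toFinset] at *
    by_contra hn
    have := mem_Pres hn
    rw [e2] at this
    exact word_not h hk this
  have hc := Finset.card_le_card hsub
  have hnd : (i :: (i + 1) :: (a ++ b)).Nodup := by
    rw [List.nodup_cons, List.nodup_cons, List.mem_cons, not_or]
    exact ⟨⟨by omega, h.2.1⟩, h.2.2.1, h.1⟩
  rw [List.toFinset_card_of_nodup hnd] at hc
  have hc := hc.trans (List.toFinset_card_le l)
  have hpar : l.length ≠ a.length + b.length + 2 := by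
    intro hl
    have : (a ++ [i, i + 1, i] ++ b).length = l.length + 1 := by simp; omega
    rw [this, pow_succ] at e1
    have : ((-1 : ℤˣ) ^ l.length) * 1 = (-1 : ℤˣ) ^ l.length * (-1) := by rw [mul_one]; exact e1
    exact absurd (mul_left_cancel this) (by decide)
  simp at hc ⊢
  omega

theorem red_of {n : ℕ} {a b : List ℕ} {i : ℕ} (h : DW n a b i) {w : Perm (Fin n)}
    (hw : ((a ++ [i, i + 1, i] ++ b).map (simpleT n)).prod = w) :
    IsReducedWord n (a ++ [i, i + 1, i] ++ b) w := by
  refine ⟨hw, ?_⟩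
  unfold permLen
  refine le_antisymm ?_ (Nat.sInf_le ⟨_, rfl, hw⟩)
  refine le_csInf ⟨_, _, rfl, hw⟩ ?_
  rintro _ ⟨l, rfl, hl⟩
  exact lower h (hl.trans hw.symm)

theorem red_ok {n : ℕ} {l : List ℕ} {w : Perm (Fin n)} (h : IsReducedWord n l w) : OK n l := by
  obtain ⟨h1, h2⟩ := h
  have h3 : permLen n w ≤ (good n l).length := Nat.sInf_le ⟨_, rfl, by rw [good_prod, h1]⟩
  have h4 : good n l = l := by
    refine List.Sublist.eq_of_length_le List.filter_sublist ?_
    show _ ≤ (good n l).length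
    omega
  rw [← h4]; exact good_ok n l

theorem O3_lt {n : ℕ} {w : Perm ℕ} (hw : FX n w) {a b c : ℕ} (h : O3 w a b c) : c < n := by
  unfold O3 at h
  by_contra hc
  have h1 := hw c (by omega)
  rcases lt_or_ge a n with ha | ha
  · have := hw.lt ha; omega
  · have := hw a ha; omega

theorem O4_lt {n : ℕ} {w : Perm ℕ} (hw : FX n w) {a b c d : ℕ} (h : O4 w a b c d) : d < n := by
  unfold O4 at h
  by_contra hc
  have h1 := hw d (by omega)
  rcases lt_or_ge a n with ha | ha
  · have := hw.lt ha; omega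
  · have := hw a ha; omega

theorem occ3 {n : ℕ} (w : Perm (Fin n)) (j : Fin 3 → Fin n) :
    IsPatternOcc w pattern321 j ↔ O3 (F n w) (j 0) (j 1) (j 2) := by
  have p0 : pattern321 0 = 2 := by decide
  have p1 : pattern321 1 = 1 := by decide
  have p2 : pattern321 2 = 0 := by decide
  unfold O3 IsPatternOcc
  rw [F_apply, F_apply, F_apply, Fin.strictMono_iff_lt_succ]
  simp only [Fin.forall_fin_succ, Fin.forall_fin_zero, p0, p1, p2, Fin.lt_def]
  simp [p0, p1, p2]
  omega

theorem occ4 {n : ℕ} (w : Perm (Fin n)) (j : Fin 4 → Fin n) :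
    IsPatternOcc w pattern3412 j ↔ O4 (F n w) (j 0) (j 1) (j 2) (j 3) := by
  have p0 : pattern3412 0 = 2 := by decide
  have p1 : pattern3412 1 = 3 := by decide
  have p2 : pattern3412 2 = 0 := by decide
  have p3 : pattern3412 3 = 1 := by decide
  unfold O4 IsPatternOcc
  rw [F_apply, F_apply, F_apply, F_apply, Fin.strictMono_iff_lt_succ]
  simp only [Fin.forall_fin_succ, Fin.forall_fin_zero, p0, p1, p2, Fin.lt_def]
  simp [p0, p1, p2, p3]
  omega

theorem once_iff {n : ℕ} (w : Perm (Fin n)) : ContainsPatternOnce w pattern321 ↔ U3 (F n w) := by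
  constructor
  · rintro ⟨j, h1, h2⟩
    refine ⟨j 0, j 1, j 2, (occ3 w j).1 h1, ?_⟩
    intro a b c hh
    have hc := O3_lt (F_fx w) hh
    have hh' := hh
    unfold O3 at hh'
    have := h2 ![⟨a, by omega⟩, ⟨b, by omega⟩, ⟨c, hc⟩] ((occ3 _ _).2 (by simpa using hh))
    rw [← this]
    simp
  · rintro ⟨a, b, c, hh, h2⟩
    have hc := O3_lt (F_fx w) hh
    have hh' := hh
    unfold O3 at hh'
    refine ⟨![⟨a, by omega⟩, ⟨b, by omega⟩, ⟨c, hc⟩], (occ3 _ _).2 (by simpa using hh), ?_⟩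
    intro j hj
    obtain ⟨e1, e2, e3⟩ := h2 _ _ _ ((occ3 _ _).1 hj)
    ext k
    fin_cases k <;> simp [e1, e2, e3]

theorem avoid_iff {n : ℕ} (w : Perm (Fin n)) : AvoidsPattern w pattern3412 ↔ N4 (F n w) := by
  constructor
  · intro h a b c d hh
    have hc := O4_lt (F_fx w) hh
    have hh' := hh
    unfold O4 at hh'
    exact h ⟨![⟨a, by omega⟩, ⟨b, by omega⟩, ⟨c, by omega⟩, ⟨d, hc⟩],
      (occ4 _ _).2 (by simpa using hh)⟩
  · rintro h ⟨j, hj⟩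
    exact h _ _ _ _ ((occ4 _ _).1 hj)

end Daly

/-- `w` contains the pattern 321 exactly once and avoids 3412 iff some
reduced decomposition of `w` contains a factor `sᵢ sᵢ₊₁ sᵢ` in which the letter `i` occurs
exactly twice and every other letter occurs exactly once. -/
theorem stmt0 (n : ℕ) (hn : 1 ≤ n) (w : Equiv.Perm (Fin n)) :
    (ContainsPatternOnce w pattern321 ∧ AvoidsPattern w pattern3412) ↔
      ∃ word : List ℕ, IsReducedWord n word w ∧
        ∃ (a b : List ℕ) (i : ℕ), word = a ++ [i, i + 1, i] ++ b ∧
          word.count i = 2 ∧ ∀ j : ℕ, j ≠ i → j ∈ word → word.count j = 1 := by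
  rw [Daly.once_iff, Daly.avoid_iff]
  constructor
  · rintro ⟨h3, h4⟩
    obtain ⟨a, b, i, hD, he⟩ := (Daly.D_of (Daly.F_fx w) h3 h4).word
    have hi := hD.2.2.2.2.1
    refine ⟨_, Daly.red_of hD ?_, a, b, i, rfl, ?_, ?_⟩
    · apply Daly.F_inj
      rw [Daly.F_prod hD.ok, Daly.P_dw hi, he]
    · have h1 := List.count_eq_zero_of_not_mem hD.2.1
      rw [List.count_append] at h1
      simp [List.count_append, List.count_cons]
      omega
    · intro j hj hm
      have h1 := List.nodup_iff_count_le_one.1 hD.1 j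
      have hp := List.count_pos_iff.2 hm
      have h3 := hD.2.2.1
      by_cases e : j = i + 1
      · subst e
        have h1 := List.count_eq_zero_of_not_mem h3
        rw [List.count_append] at h1
        simp [List.count_append, List.count_cons]
        omega
      · have e1 : ¬ i = j := fun h => hj h.symm
        have e2 : ¬ i + 1 = j := fun h => e h.symm
        have hz : List.count j [i, i + 1, i] = 0 :=
          List.count_eq_zero.2 (by simp [hj, e])
        simp only [List.count_append, hz] at hp h1 ⊢
        omega
  · rintro ⟨_, hr, a, b, i, rfl, hc, hu⟩
    have ok := Daly.red_ok hr
    have hi := ok i (by simp)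
    have hi1 := ok (i + 1) (by simp)
    have hD : Daly.DW n a b i := by
      have hc' : (a ++ b).count i = 0 := by
        simp [List.count_append, List.count_cons] at hc
        rw [List.count_append]; omega
      have hc1 : (a ++ b).count (i + 1) = 0 := by
        have := hu (i + 1) (by omega) (by simp)
        simp [List.count_append, List.count_cons] at this
        rw [List.count_append]; omega
      refine ⟨?_, List.count_eq_zero.1 hc', List.count_eq_zero.1 hc1, ?_, hi.1, hi1.2⟩
      · rw [List.nodup_iff_count_le_one]
        intro j
        by_cases hj : j = i
        · subst hj; omega
        by_cases hm : j ∈ a ++ b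
        · have := hu j hj (by simp at hm ⊢; tauto)
          simp only [List.count_append] at this ⊢
          omega
        · rw [List.count_eq_zero_of_not_mem hm]; omega
      · intro k hk
        exact ok k (by simp at hk ⊢; tauto)
    have := (Daly.D_of_word hD).av
    rwa [← Daly.P_dw hi.1, ← Daly.F_prod ok, hr.1] at this
end

section
/- Let n be a positive integer and w a permutation in the symmetric group S_n. Then w contains the pattern 3412 exactly once and avoids the pattern 321 if and only if there exist a reduced decomposition w = s_{i_1}⋯s_{i_ℓ} (ℓ = ℓ(w)) and an index q with 1 ≤ q ≤ ℓ−3 such that (i_q, i_{q+1}, i_{q+2}, i_{q+3}) = (i+1, i, i+2, i+1) for some i, the letter i+1 occurs exactly twice among i_1,…,i_ℓ, and every other letter occurs exactly once. -/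
/-! ### Helper material -/

/-- Occurrence of 3412 spelled out. -/
def Occ4 {n : ℕ} (w : Equiv.Perm (Fin n)) (a b c d : Fin n) : Prop :=
  a < b ∧ b < c ∧ c < d ∧ w c < w d ∧ w d < w a ∧ w a < w b

def PP {n : ℕ} (w : Equiv.Perm (Fin n)) : Prop :=
  (∃ a b c d, Occ4 w a b c d ∧ ∀ a' b' c' d', Occ4 w a' b' c' d' →
    a' = a ∧ b' = b ∧ c' = c ∧ d' = d) ∧
  ∀ a b c, a < b → b < c → w c < w b → w b < w a → False

theorem occ3412_iff {n : ℕ} (w : Equiv.Perm (Fin n)) (j : Fin 4 → Fin n) :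
    IsPatternOcc w pattern3412 j ↔ Occ4 w (j 0) (j 1) (j 2) (j 3) := by
  have p0 : pattern3412 0 = 2 := by decide
  have p1 : pattern3412 1 = 3 := by decide
  have p2 : pattern3412 2 = 0 := by decide
  have p3 : pattern3412 3 = 1 := by decide
  constructor
  · rintro ⟨hm, h⟩
    refine ⟨hm (by decide), hm (by decide), hm (by decide), ?_, ?_, ?_⟩
    · rw [h, p2, p3]; decide
    · rw [h, p0, p3]; decide
    · rw [h, p0, p1]; decide
  · rintro ⟨h1, h2, h3, h4, h5, h6⟩
    refine ⟨?_, ?_⟩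
    · rw [Fin.strictMono_iff_lt_succ]
      intro i
      fin_cases i
      · exact h1
      · exact h2
      · exact h3
    · intro a b
      fin_cases a <;> fin_cases b <;> simp [p0, p1, p2, p3] <;> order

theorem occ321_iff {n : ℕ} (w : Equiv.Perm (Fin n)) (j : Fin 3 → Fin n) :
    IsPatternOcc w pattern321 j ↔
      j 0 < j 1 ∧ j 1 < j 2 ∧ w (j 2) < w (j 1) ∧ w (j 1) < w (j 0) := by
  have p0 : pattern321 0 = 2 := by decide
  have p1 : pattern321 1 = 1 := by decide
  have p2 : pattern321 2 = 0 := by decide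
  constructor
  · rintro ⟨hm, h⟩
    refine ⟨hm (by decide), hm (by decide), ?_, ?_⟩
    · rw [h, p2, p1]; decide
    · rw [h, p0, p1]; decide
  · rintro ⟨h1, h2, h3, h4⟩
    refine ⟨?_, ?_⟩
    · rw [Fin.strictMono_iff_lt_succ]
      intro i
      fin_cases i
      · exact h1
      · exact h2
    · intro a b
      fin_cases a <;> fin_cases b <;> simp [p0, p1, p2] <;> order

theorem PP_iff {n : ℕ} (w : Equiv.Perm (Fin n)) :
    (ContainsPatternOnce w pattern3412 ∧ AvoidsPattern w pattern321) ↔ PP w := by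
  unfold PP
  refine and_congr ?_ ?_
  · constructor
    · rintro ⟨j, hj, hu⟩
      refine ⟨j 0, j 1, j 2, j 3, (occ3412_iff w j).1 hj, ?_⟩
      intro a b c d h
      have := hu ![a, b, c, d] ((occ3412_iff w _).2 (by simpa using h))
      rw [← this]
      simp
    · rintro ⟨a, b, c, d, h, hu⟩
      refine ⟨![a, b, c, d], (occ3412_iff w _).2 (by simpa using h), ?_⟩
      intro j hj
      obtain ⟨h0, h1, h2, h3⟩ := hu _ _ _ _ ((occ3412_iff w j).1 hj)
      funext x
      fin_cases x
      · exact h0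
      · exact h1
      · exact h2
      · exact h3
  · constructor
    · intro h a b c hab hbc h1 h2
      exact h ⟨![a, b, c], (occ321_iff w _).2 (by simpa using ⟨hab, hbc, h1, h2⟩)⟩
    · rintro h ⟨j, hj⟩
      obtain ⟨h1, h2, h3, h4⟩ := (occ321_iff w j).1 hj
      exact h _ _ _ h1 h2 h3 h4

/-- Stabilizer of the first `k` points. -/
def Stb (n k : ℕ) : Subgroup (Equiv.Perm (Fin n)) where
  carrier := {σ | ∀ x : Fin n, ((σ x : Fin n) : ℕ) < k ↔ (x : ℕ) < k}
  one_mem' := by intro x; simp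
  mul_mem' := by
    intro a b ha hb x
    rw [Equiv.Perm.mul_apply, ha, hb]
  inv_mem' := by
    intro a ha x
    have := ha (a⁻¹ x)
    have e : a (a⁻¹ x) = x := by simp
    rw [e] at this
    exact this.symm

theorem mem_Stb {n k : ℕ} {σ : Equiv.Perm (Fin n)} :
    σ ∈ Stb n k ↔ ∀ x : Fin n, ((σ x : Fin n) : ℕ) < k ↔ (x : ℕ) < k := Iff.rfl

theorem simpleT_val {n j : ℕ} (h : 1 ≤ j ∧ j < n) (x : Fin n) :
    ((x : ℕ) = j - 1 ∧ ((simpleT n j x : Fin n) : ℕ) = j) ∨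
    ((x : ℕ) = j ∧ ((simpleT n j x : Fin n) : ℕ) = j - 1) ∨
    ((x : ℕ) ≠ j - 1 ∧ (x : ℕ) ≠ j ∧ ((simpleT n j x : Fin n) : ℕ) = x) := by
  unfold simpleT
  rw [dif_pos h, Equiv.swap_apply_def]
  simp only [Fin.ext_iff]
  split_ifs with h1 h2
  · left; simpa using h1
  · right; left; simpa using h2
  · right; right; simp_all

theorem simpleT_mul_self (n j : ℕ) : simpleT n j * simpleT n j = 1 := by
  unfold simpleT
  split_ifs <;> simp

theorem simpleT_inv (n j : ℕ) : (simpleT n j)⁻¹ = simpleT n j :=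
  inv_eq_of_mul_eq_one_left (simpleT_mul_self n j)

theorem simpleT_mem {n j k : ℕ} (h : j ≠ k) : simpleT n j ∈ Stb n k := by
  by_cases hv : 1 ≤ j ∧ j < n
  · intro x
    have := simpleT_val hv x
    omega
  · unfold simpleT; rw [dif_neg hv]; exact one_mem _

theorem simpleT_not_mem {n j : ℕ} (hv : 1 ≤ j ∧ j < n) : simpleT n j ∉ Stb n j := by
  intro h
  have h1 := h ⟨j, hv.2⟩
  have := simpleT_val hv ⟨j, hv.2⟩
  simp only at h1 this
  omega

theorem word_mem {n k : ℕ} (l : List ℕ) (h : k ∉ l) : (l.map (simpleT n)).prod ∈ Stb n k := by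
  apply Subgroup.list_prod_mem
  intro x hx
  obtain ⟨j, hj, rfl⟩ := List.mem_map.1 hx
  exact simpleT_mem (by rintro rfl; exact h hj)

theorem PP_left {n j : ℕ} (hv : 1 ≤ j ∧ j < n) {w : Equiv.Perm (Fin n)} (hw : w ∈ Stb n j) :
    PP (simpleT n j * w) ↔ PP w := by
  have key4 : ∀ a b c d, Occ4 (simpleT n j * w) a b c d ↔ Occ4 w a b c d := by
    intro a b c d
    have ha := hw a
    have hb := hw b
    have hc := hw c
    have hd := hw d
    have sa := simpleT_val hv (w a)
    have sb := simpleT_val hv (w b)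
    have sc := simpleT_val hv (w c)
    have sd := simpleT_val hv (w d)
    simp only [Occ4, Equiv.Perm.mul_apply, Fin.lt_def]
    constructor
    · rintro ⟨h1, h2, h3, h4, h5, h6⟩
      refine ⟨h1, h2, h3, ?_, ?_, ?_⟩ <;> omega
    · rintro ⟨h1, h2, h3, h4, h5, h6⟩
      refine ⟨h1, h2, h3, ?_, ?_, ?_⟩ <;> omega
  have key3 : ∀ a b c : Fin n, a < b → b < c →
      (((simpleT n j * w) c < (simpleT n j * w) b ∧ (simpleT n j * w) b < (simpleT n j * w) a) ↔
      (w c < w b ∧ w b < w a)) := by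
    intro a b c
    have ha := hw a
    have hb := hw b
    have hc := hw c
    have sa := simpleT_val hv (w a)
    have sb := simpleT_val hv (w b)
    have sc := simpleT_val hv (w c)
    simp only [Equiv.Perm.mul_apply, Fin.lt_def]
    intro h1 h2
    constructor
    · rintro ⟨h4, h5⟩
      refine ⟨?_, ?_⟩ <;> omega
    · rintro ⟨h4, h5⟩
      refine ⟨?_, ?_⟩ <;> omega
  unfold PP
  simp only [key4]
  refine and_congr Iff.rfl ?_
  constructor
  · intro h a b c h1 h2 h3 h4
    have := (key3 a b c h1 h2).2 ⟨h3, h4⟩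
    exact h a b c h1 h2 this.1 this.2
  · intro h a b c h1 h2 h3 h4
    have := (key3 a b c h1 h2).1 ⟨h3, h4⟩
    exact h a b c h1 h2 this.1 this.2

theorem Occ4_inv {n : ℕ} {w : Equiv.Perm (Fin n)} {a b c d : Fin n} (h : Occ4 w a b c d) :
    Occ4 w⁻¹ (w c) (w d) (w a) (w b) := by
  obtain ⟨h1, h2, h3, h4, h5, h6⟩ := h
  exact ⟨h4, h5, h6, by simpa using h1, by simpa using h2, by simpa using h3⟩

theorem PP_inv {n : ℕ} {w : Equiv.Perm (Fin n)} (h : PP w) : PP w⁻¹ := by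
  obtain ⟨⟨a, b, c, d, ho, hu⟩, h3⟩ := h
  refine ⟨⟨w c, w d, w a, w b, Occ4_inv ho, ?_⟩, ?_⟩
  · intro a' b' c' d' h'
    have := Occ4_inv h'
    rw [inv_inv] at this
    obtain ⟨e1, e2, e3, e4⟩ := hu _ _ _ _ this
    subst e1 e2 e3 e4
    simp
  · intro a b c h1 h2 h4 h5
    exact h3 (w⁻¹ c) (w⁻¹ b) (w⁻¹ a) h4 h5 (by simpa using h1) (by simpa using h2)

theorem PP_inv_iff {n : ℕ} {w : Equiv.Perm (Fin n)} : PP w⁻¹ ↔ PP w :=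
  ⟨fun h => by simpa using PP_inv h, PP_inv⟩

theorem PP_right {n j : ℕ} (hv : 1 ≤ j ∧ j < n) {w : Equiv.Perm (Fin n)} (hw : w ∈ Stb n j) :
    PP (w * simpleT n j) ↔ PP w := by
  rw [← PP_inv_iff, mul_inv_rev, simpleT_inv, PP_left hv (inv_mem hw), PP_inv_iff]

/-- The core factor. -/
def FF (i : ℕ) : List ℕ := [i + 1, i, i + 2, i + 1]

theorem FF_val {n i : ℕ} (h1 : 1 ≤ i) (h2 : i + 2 < n) (x : Fin n) :
    ((x : ℕ) + 1 = i ∧ ((((FF i).map (simpleT n)).prod x : Fin n) : ℕ) = i + 1) ∨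
    ((x : ℕ) = i ∧ ((((FF i).map (simpleT n)).prod x : Fin n) : ℕ) = i + 2) ∨
    ((x : ℕ) = i + 1 ∧ ((((FF i).map (simpleT n)).prod x : Fin n) : ℕ) + 1 = i) ∨
    ((x : ℕ) = i + 2 ∧ ((((FF i).map (simpleT n)).prod x : Fin n) : ℕ) = i) ∨
    (((x : ℕ) + 1 < i ∨ i + 2 < (x : ℕ)) ∧
      ((((FF i).map (simpleT n)).prod x : Fin n) : ℕ) = x) := by
  simp only [FF, List.map_cons, List.map_nil, List.prod_cons, List.prod_nil, mul_one,
    Equiv.Perm.mul_apply]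
  have e1 := simpleT_val (n := n) (j := i + 1) ⟨by omega, by omega⟩ x
  generalize simpleT n (i + 1) x = y at *
  have e2 := simpleT_val (n := n) (j := i + 2) ⟨by omega, by omega⟩ y
  generalize simpleT n (i + 2) y = z at *
  have e3 := simpleT_val (n := n) (j := i) ⟨by omega, by omega⟩ z
  generalize simpleT n i z = t at *
  have e4 := simpleT_val (n := n) (j := i + 1) ⟨by omega, by omega⟩ t
  generalize simpleT n (i + 1) t = s at *
  have hx : (x : ℕ) + 1 = i ∨ (x : ℕ) = i ∨ (x : ℕ) = i + 1 ∨ (x : ℕ) = i + 2 ∨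
    ((x : ℕ) + 1 < i ∨ i + 2 < (x : ℕ)) := by omega
  rcases hx with hx | hx | hx | hx | hx
  · left
    have f1 : (y : ℕ) = x := by clear e2 e3 e4; omega
    have f2 : (z : ℕ) = x := by clear e1 e3 e4; omega
    have f3 : (t : ℕ) = i := by clear e1 e2 e4; omega
    clear e1 e2 e3; omega
  · right; left
    have f1 : (y : ℕ) = i + 1 := by clear e2 e3 e4; omega
    have f2 : (z : ℕ) = i + 2 := by clear e1 e3 e4; omega
    have f3 : (t : ℕ) = i + 2 := by clear e1 e2 e4; omega
    clear e1 e2 e3; omega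
  · right; right; left
    have f1 : (y : ℕ) = i := by clear e2 e3 e4; omega
    have f2 : (z : ℕ) = i := by clear e1 e3 e4; omega
    have f3 : (t : ℕ) = i - 1 := by clear e1 e2 e4; omega
    clear e1 e2 e3; omega
  · right; right; right; left
    have f1 : (y : ℕ) = i + 2 := by clear e2 e3 e4; omega
    have f2 : (z : ℕ) = i + 1 := by clear e1 e3 e4; omega
    have f3 : (t : ℕ) = i + 1 := by clear e1 e2 e4; omega
    clear e1 e2 e3; omega
  · right; right; right; right
    refine ⟨hx, ?_⟩
    have f1 : (y : ℕ) = x := by clear e2 e3 e4; omega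
    have f2 : (z : ℕ) = x := by clear e1 e3 e4; omega
    have f3 : (t : ℕ) = x := by clear e1 e2 e4; omega
    clear e1 e2 e3; omega

theorem PP_FF {n i : ℕ} (h1 : 1 ≤ i) (h2 : i + 2 < n) : PP ((FF i).map (simpleT n)).prod := by
  have hF := FF_val (n := n) h1 h2
  generalize ((FF i).map (simpleT n)).prod = w at *
  refine ⟨⟨⟨i - 1, by omega⟩, ⟨i, by omega⟩, ⟨i + 1, by omega⟩, ⟨i + 2, by omega⟩, ?_, ?_⟩, ?_⟩
  · have a1 := hF ⟨i - 1, by omega⟩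
    have a2 := hF ⟨i, by omega⟩
    have a3 := hF ⟨i + 1, by omega⟩
    have a4 := hF ⟨i + 2, by omega⟩
    simp only [Occ4, Fin.lt_def] at *
    refine ⟨?_, ?_, ?_, ?_, ?_, ?_⟩ <;> omega
  · intro a b c d h
    have a1 := hF a
    have a2 := hF b
    have a3 := hF c
    have a4 := hF d
    simp only [Occ4, Fin.lt_def, Fin.ext_iff] at *
    obtain ⟨g1, g2, g3, g4, g5, g6⟩ := h
    refine ⟨?_, ?_, ?_, ?_⟩ <;> omega
  · intro a b c g1 g2 g3 g4
    have a1 := hF a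
    have a2 := hF b
    have a3 := hF c
    simp only [Fin.lt_def] at *
    omega

/-- Structured form of the words in the theorem. -/
def GoodW (n : ℕ) (a b : List ℕ) (i : ℕ) : Prop :=
  (∀ j ∈ a ++ FF i ++ b, 1 ≤ j ∧ j < n) ∧ (a ++ b).Nodup ∧
    i ∉ a ++ b ∧ i + 1 ∉ a ++ b ∧ i + 2 ∉ a ++ b

theorem GoodW.bd {n i : ℕ} {a b : List ℕ} (h : GoodW n a b i) : 1 ≤ i ∧ i + 2 < n :=
  ⟨(h.1 i (by simp [FF])).1, (h.1 (i + 2) (by simp [FF])).2⟩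

theorem GoodW.PP {n i : ℕ} {a b : List ℕ} (h : GoodW n a b i) :
    PP ((a ++ FF i ++ b).map (simpleT n)).prod := by
  induction a with
  | nil =>
    induction b using List.reverseRecOn with
    | nil => simpa using PP_FF h.bd.1 h.bd.2
    | append_singleton b x ih =>
      obtain ⟨hv, hnd, h0, h1, h2⟩ := h
      simp only [List.nil_append, List.mem_append, List.mem_singleton, not_or] at *
      have := ih ⟨by intro j hj; apply hv j; simp at hj; tauto, by
        rw [List.nodup_append] at hnd; exact hnd.1, by simp; tauto, by simp; tauto, by simp; tauto⟩
      rw [← List.append_assoc, List.map_append, List.prod_append]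
      simp only [List.map_cons, List.map_nil, List.prod_cons, List.prod_nil, mul_one]
      rw [PP_right (hv x (by simp))]
      · exact this
      · apply word_mem
        have hx : x ∉ b := by
          rw [List.nodup_append] at hnd
          intro hx
          exact hnd.2.2 x hx x (by simp) rfl
        simp only [FF, List.mem_append, List.mem_cons, List.not_mem_nil, or_false, not_or]
        refine ⟨⟨?_, ?_, ?_, ?_⟩, hx⟩ <;> rintro rfl <;> tauto
  | cons x a ih =>
    obtain ⟨hv, hnd, h0, h1, h2⟩ := h
    simp only [List.cons_append, List.nodup_cons, List.mem_cons, not_or] at *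
    have := ih ⟨fun j hj => hv j (Or.inr hj), hnd.2, h0.2, h1.2, h2.2⟩
    rw [List.map_cons, List.prod_cons, PP_left (hv x (by simp))]
    · exact this
    · apply word_mem
      have := hnd.1
      simp [FF] at *
      tauto

theorem GoodW.not_mem {n i : ℕ} {a b : List ℕ} (h : GoodW n a b i) {k : ℕ}
    (hk : k ∈ a ++ FF i ++ b) : ((a ++ FF i ++ b).map (simpleT n)).prod ∉ Stb n k := by
  have hbd := h.bd
  obtain ⟨hv, hnd, h0, h1, h2⟩ := h
  have hvk := hv k hk
  by_cases hki : k = i + 1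
  · subst hki
    simp only [List.mem_append, not_or] at h1
    rw [List.map_append, List.map_append, List.prod_append, List.prod_append,
      Subgroup.mul_mem_cancel_right _ (word_mem b h1.2),
      Subgroup.mul_mem_cancel_left _ (word_mem a h1.1)]
    intro hm
    have e := hm ⟨i, by omega⟩
    have e2 := FF_val hbd.1 hbd.2 ⟨i, by omega⟩
    simp only at e e2
    omega
  · have hs : ∃ c d, a ++ FF i ++ b = c ++ k :: d ∧ k ∉ c ∧ k ∉ d := by
      have hc : (a ++ FF i ++ b).count k = 1 := by
        have e : (a ++ b).count k ≤ 1 := List.nodup_iff_count_le_one.1 hnd k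
        have f : k ∈ FF i → (a ++ b).count k = 0 := by
          intro hf
          rw [List.count_eq_zero]
          simp only [FF, List.mem_cons, List.not_mem_nil, or_false] at hf
          rcases hf with rfl | rfl | rfl | rfl <;> assumption
        have g : k ∈ FF i → (FF i).count k = 1 := by
          intro hf
          simp only [FF, List.mem_cons, List.not_mem_nil, or_false] at hf
          rcases hf with rfl | rfl | rfl | rfl
          · exact absurd rfl hki
          · simp [FF, List.count_cons]
          · simp [FF, List.count_cons]
          · exact absurd rfl hki
        have g' : k ∉ FF i → (FF i).count k = 0 := fun hf => List.count_eq_zero.2 hf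
        have p : 0 < (a ++ FF i ++ b).count k := List.count_pos_iff.2 hk
        simp only [List.count_append] at *
        by_cases hf : k ∈ FF i
        · have := f hf; have := g hf; omega
        · have := g' hf; omega
      obtain ⟨c, d, hcd⟩ := List.append_of_mem hk
      refine ⟨c, d, hcd, ?_⟩
      rw [hcd, List.count_append, List.count_cons_self] at hc
      exact ⟨List.count_eq_zero.1 (by omega), List.count_eq_zero.1 (by omega)⟩
    obtain ⟨c, d, e, hc, hd⟩ := hs
    rw [e, List.map_append, List.prod_append, List.map_cons, List.prod_cons,
      Subgroup.mul_mem_cancel_left _ (word_mem c hc),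
      Subgroup.mul_mem_cancel_right _ (word_mem d hd)]
    exact simpleT_not_mem hvk

theorem reduced_valid {n : ℕ} {l : List ℕ} {w : Equiv.Perm (Fin n)} (h : IsReducedWord n l w) :
    ∀ j ∈ l, 1 ≤ j ∧ j < n := by
  intro j hj
  by_contra hv
  obtain ⟨c, d, rfl⟩ := List.append_of_mem hj
  obtain ⟨h1, h2⟩ := h
  have : permLen n w ≤ (c ++ d).length := by
    apply Nat.sInf_le
    refine ⟨c ++ d, rfl, ?_⟩
    rw [← h1]
    have : simpleT n j = 1 := by unfold simpleT; rw [dif_neg hv]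
    simp [this]
  simp at h2 this
  omega

theorem exists_reduced {n : ℕ} {l : List ℕ} {w : Equiv.Perm (Fin n)}
    (h : (l.map (simpleT n)).prod = w) : ∃ l', IsReducedWord n l' w := by
  have : permLen n w ∈ {l : ℕ | ∃ word : List ℕ, word.length = l ∧
      (word.map (simpleT n)).prod = w} := Nat.sInf_mem ⟨_, l, rfl, h⟩
  obtain ⟨l', h1, h2⟩ := this
  exact ⟨l', h2, h1⟩

theorem sign_word {n : ℕ} (l : List ℕ) (h : ∀ j ∈ l, 1 ≤ j ∧ j < n) :
    Equiv.Perm.sign (l.map (simpleT n)).prod = (-1) ^ l.length := by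
  induction l with
  | nil => simp
  | cons x l ih =>
    have hx := h x (by simp)
    rw [List.map_cons, List.prod_cons, map_mul, ih (fun j hj => h j (by simp [hj])),
      List.length_cons, pow_succ']
    congr 1
    unfold simpleT
    rw [dif_pos hx, Equiv.Perm.sign_swap]
    rw [Ne, Fin.ext_iff]
    simp only
    omega

theorem GoodW.reduced {n i : ℕ} {a b : List ℕ} (h : GoodW n a b i) :
    IsReducedWord n (a ++ FF i ++ b) ((a ++ FF i ++ b).map (simpleT n)).prod := by
  refine ⟨rfl, ?_⟩
  obtain ⟨l', hl⟩ := exists_reduced (n := n) (l := a ++ FF i ++ b) rfl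
  have hv' := reduced_valid hl
  obtain ⟨hp, hlen⟩ := hl
  have hle : permLen n ((a ++ FF i ++ b).map (simpleT n)).prod ≤ (a ++ FF i ++ b).length :=
    Nat.sInf_le ⟨_, rfl, rfl⟩
  rw [← hlen] at hle ⊢
  have hsub : ∀ k ∈ a ++ FF i ++ b, k ∈ l' := by
    intro k hk
    by_contra hkl
    apply h.not_mem hk
    rw [← hp]
    exact word_mem l' hkl
  have hs := sign_word _ h.1
  rw [← hp, sign_word _ hv'] at hs
  have hnd : (i :: (i + 1) :: (i + 2) :: (a ++ b)).Nodup := by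
    obtain ⟨_, h1, h2, h3, h4⟩ := h
    simp only [List.nodup_cons, List.mem_cons, not_or]
    refine ⟨⟨by omega, by omega, h2⟩, ⟨by omega, h3⟩, h4, h1⟩
  have hlen2 := (List.subperm_of_subset hnd (l₂ := l') (by
    intro k hk
    apply hsub
    simp [FF] at *
    tauto)).length_le
  have e : (a ++ FF i ++ b).length = a.length + b.length + 4 := by simp [FF]; omega
  simp only [List.length_cons, List.length_append] at hlen2
  rw [e] at hle hs ⊢
  by_contra hne
  have : l'.length = a.length + b.length + 3 := by omega
  rw [this, pow_succ _ (a.length + b.length + 3)] at hs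
  rcases neg_one_pow_eq_or ℤˣ (a.length + b.length + 3) with q | q <;> rw [q] at hs <;>
    revert hs <;> decide

def QQ (n : ℕ) (w : Equiv.Perm (Fin n)) : Prop :=
  ∃ a b i, GoodW n a b i ∧ ((a ++ FF i ++ b).map (simpleT n)).prod = w

theorem QQ_left {n j : ℕ} (hv : 1 ≤ j ∧ j < n) {w : Equiv.Perm (Fin n)} (hw : w ∈ Stb n j)
    (h : QQ n w) : QQ n (simpleT n j * w) := by
  obtain ⟨a, b, i, hg, rfl⟩ := h
  have hj : j ∉ a ++ FF i ++ b := fun hj => hg.not_mem hj hw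
  refine ⟨j :: a, b, i, ?_, by simp⟩
  obtain ⟨h1, h2, h3, h4, h5⟩ := hg
  simp only [FF, List.mem_append, List.mem_cons, List.not_mem_nil, or_false, not_or] at hj
  refine ⟨?_, ?_, ?_, ?_, ?_⟩
  · intro k hk
    simp only [List.cons_append, List.mem_cons] at hk
    rcases hk with rfl | hk
    · exact hv
    · exact h1 k hk
  · simp only [List.cons_append, List.nodup_cons, List.mem_append]
    exact ⟨by tauto, h2⟩
  all_goals
    simp only [List.cons_append, List.mem_cons, not_or]
    refine ⟨?_, by assumption⟩
    omega

theorem QQ_right {n j : ℕ} (hv : 1 ≤ j ∧ j < n) {w : Equiv.Perm (Fin n)} (hw : w ∈ Stb n j)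
    (h : QQ n w) : QQ n (w * simpleT n j) := by
  obtain ⟨a, b, i, hg, rfl⟩ := h
  have hj : j ∉ a ++ FF i ++ b := fun hj => hg.not_mem hj hw
  refine ⟨a, b ++ [j], i, ?_, by simp [mul_assoc]⟩
  obtain ⟨h1, h2, h3, h4, h5⟩ := hg
  simp only [FF, List.mem_append, List.mem_cons, List.not_mem_nil, or_false, not_or] at hj
  refine ⟨?_, ?_, ?_, ?_, ?_⟩
  · intro k hk
    rw [← List.append_assoc, List.mem_append, List.mem_singleton] at hk
    rcases hk with hk | rfl
    · exact h1 k hk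
    · exact hv
  · rw [← List.append_assoc, List.nodup_append]
    refine ⟨h2, by simp, ?_⟩
    intro x hx y hy
    simp only [List.mem_singleton] at hy
    subst hy
    rintro rfl
    simp only [List.mem_append] at hx
    tauto
  all_goals
    rw [← List.append_assoc, List.mem_append, List.mem_singleton, not_or]
    refine ⟨by assumption, ?_⟩
    omega

theorem Stb_of_fix_lt {n k : ℕ} {w : Equiv.Perm (Fin n)}
    (h : ∀ x : Fin n, (x : ℕ) < k → w x = x) : w ∈ Stb n k := by
  intro x
  constructor
  · intro hx
    have := h _ hx
    rw [w.injective this] at hx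
    exact hx
  · intro hx; rw [h x hx]; exact hx

theorem Stb_of_fix_ge {n k : ℕ} {w : Equiv.Perm (Fin n)}
    (h : ∀ x : Fin n, k ≤ (x : ℕ) → w x = x) : w ∈ Stb n k := by
  intro x
  constructor
  · intro hx
    by_contra hc
    rw [h x (by omega)] at hx
    exact hc hx
  · intro hx
    by_contra hc
    have := h _ (not_lt.1 hc)
    rw [w.injective this] at hc
    exact hc hx

open Classical in
noncomputable def msr (n : ℕ) (w : Equiv.Perm (Fin n)) : ℕ :=
  ((Finset.range n).filter (fun k => w ∉ Stb n k)).card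

theorem msr_lt {n j : ℕ} (hv : 1 ≤ j ∧ j < n) {v w : Equiv.Perm (Fin n)}
    (hw : v ∈ Stb n j) (hw' : w ∉ Stb n j) (h : ∀ k, k ≠ j → (v ∈ Stb n k ↔ w ∈ Stb n k)) :
    msr n v < msr n w := by
  unfold msr
  apply Finset.card_lt_card
  rw [Finset.ssubset_iff_of_subset]
  · exact ⟨j, by simp [hw', hv.2], by simp [hw]⟩
  · intro k hk
    simp only [Finset.mem_filter] at *
    have : k ≠ j := by rintro rfl; exact hk.2 hw
    rw [h k this] at hk
    exact hk

theorem main_fwd (n : ℕ) : ∀ (N : ℕ) (w : Equiv.Perm (Fin n)), msr n w = N → PP w → QQ n w := by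
  intro N
  induction N using Nat.strong_induction_on with
  | _ N ih =>
  intro w hN hP
  subst hN
  -- peeling
  have peelL : ∀ j, (1 ≤ j ∧ j < n) → simpleT n j * w ∈ Stb n j → QQ n w := by
    intro j hv hm
    have e : simpleT n j * (simpleT n j * w) = w := by
      rw [← mul_assoc, simpleT_mul_self, one_mul]
    rw [← e]
    apply QQ_left hv hm
    refine ih _ ?_ _ rfl ?_
    · apply msr_lt hv hm
      · intro hw
        exact simpleT_not_mem hv ((Subgroup.mul_mem_cancel_right _ hw).1 hm)
      · intro k hk
        exact Subgroup.mul_mem_cancel_left _ (simpleT_mem hk.symm)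
    · rw [← PP_left hv hm, e]; exact hP
  have peelR : ∀ j, (1 ≤ j ∧ j < n) → w * simpleT n j ∈ Stb n j → QQ n w := by
    intro j hv hm
    have e : (w * simpleT n j) * simpleT n j = w := by
      rw [mul_assoc, simpleT_mul_self, mul_one]
    rw [← e]
    apply QQ_right hv hm
    refine ih _ ?_ _ rfl ?_
    · apply msr_lt hv hm
      · intro hw
        exact simpleT_not_mem hv ((Subgroup.mul_mem_cancel_left _ hw).1 hm)
      · intro k hk
        exact Subgroup.mul_mem_cancel_right _ (simpleT_mem hk.symm)
    · rw [← PP_right hv hm, e]; exact hP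
  by_contra hQ
  obtain ⟨⟨a, b, c, d, ho, hu⟩, h3⟩ := hP
  -- min and max moved points
  have hne : (Finset.univ.filter (fun x => w x ≠ x)).Nonempty := by
    by_contra hc
    rw [Finset.not_nonempty_iff_eq_empty, Finset.filter_eq_empty_iff] at hc
    have hc' : ∀ x, w x = x := fun x => not_not.1 (hc (Finset.mem_univ x))
    obtain ⟨g1, g2, g3, g4, g5, g6⟩ := ho
    rw [hc', hc'] at g5
    exact absurd (g1.trans (g2.trans g3)) (not_lt.2 g5.le)
  obtain ⟨m, hm, hmin⟩ : ∃ m, w m ≠ m ∧ ∀ x, x < m → w x = x := by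
    refine ⟨Finset.min' _ hne, ?_, ?_⟩
    · have := Finset.min'_mem _ hne
      simpa using this
    · intro x hx
      by_contra hc
      exact absurd (Finset.min'_le _ x (by simpa using hc)) (not_le.2 hx)
  obtain ⟨M, hM, hmax⟩ : ∃ m, w m ≠ m ∧ ∀ x, m < x → w x = x := by
    refine ⟨Finset.max' _ hne, ?_, ?_⟩
    · have := Finset.max'_mem _ hne
      simpa using this
    · intro x hx
      by_contra hc
      exact absurd (Finset.le_max' _ x (by simpa using hc)) (not_le.2 hx)
  have hinj : ∀ x y, w x = w y → x = y := fun x y h => w.injective h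
  have hwm : m < w m := by
    rcases lt_trichotomy (w m) m with h | h | h
    · exact absurd (hinj _ _ (hmin _ h)) hm
    · exact absurd h hm
    · exact h
  have hwM : w M < M := by
    rcases lt_trichotomy (w M) M with h | h | h
    · exact h
    · exact absurd h hM
    · exact absurd (hinj _ _ (hmax _ h)) hM
  obtain ⟨q, hq⟩ := w.surjective m
  obtain ⟨p, hp⟩ := w.surjective M
  have hmq : m < q := by
    rcases lt_trichotomy q m with h | h | h
    · rw [hmin q h] at hq; exact absurd hq h.ne
    · subst h; exact absurd hq hm
    · exact h
  have hpM : p < M := by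
    rcases lt_trichotomy p M with h | h | h
    · exact h
    · subst h; exact absurd hp hM
    · rw [hmax p h] at hp; exact absurd hp h.ne'
  -- the next point
  have hm1 : (m : ℕ) + 1 < n := by have := (w m).2; simp only [Fin.lt_def] at hwm; omega
  have hM1 : 1 ≤ (M : ℕ) := by simp only [Fin.lt_def] at hwM; omega
  obtain ⟨m', hm'⟩ : ∃ m' : Fin n, (m' : ℕ) = m + 1 := ⟨⟨m + 1, hm1⟩, rfl⟩
  obtain ⟨M', hM'⟩ : ∃ M' : Fin n, (M' : ℕ) + 1 = M := ⟨⟨M - 1, by omega⟩, by simp; omega⟩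
  have n1 : w m ≠ m' := by
    intro h
    apply hQ
    apply peelL (m + 1) ⟨by omega, hm1⟩
    apply Stb_of_fix_lt
    intro x hx
    rw [Equiv.Perm.mul_apply]
    have e := simpleT_val (n := n) (j := m + 1) ⟨by omega, hm1⟩ (w x)
    rcases lt_or_eq_of_le (show x ≤ m by rw [Fin.le_def]; omega) with hx | hx
    · rw [hmin x hx] at *
      rw [Fin.lt_def] at hx
      rw [Fin.ext_iff]; omega
    · subst hx
      rw [h] at *
      rw [Fin.ext_iff]; omega
  have n2 : w m' ≠ m := by
    intro h
    apply hQ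
    apply peelR (m + 1) ⟨by omega, hm1⟩
    apply Stb_of_fix_lt
    intro x hx
    rw [Equiv.Perm.mul_apply]
    have e := simpleT_val (n := n) (j := m + 1) ⟨by omega, hm1⟩ x
    rcases lt_or_eq_of_le (show x ≤ m by rw [Fin.le_def]; omega) with hx | hx
    · have : simpleT n (m + 1) x = x := by
        rw [Fin.lt_def] at hx
        rw [Fin.ext_iff]; omega
      rw [this, hmin x hx]
    · subst hx
      have : simpleT n (x + 1) x = m' := by
        rw [Fin.ext_iff]; omega
      rw [this, h]
  have n3 : w M ≠ M' := by
    intro h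
    apply hQ
    apply peelL M ⟨hM1, M.2⟩
    apply Stb_of_fix_ge
    intro x hx
    rw [Equiv.Perm.mul_apply]
    have e := simpleT_val (n := n) (j := M) ⟨hM1, M.2⟩ (w x)
    rcases lt_or_eq_of_le (show M ≤ x by rw [Fin.le_def]; omega) with hx | hx
    · rw [hmax x hx] at *
      rw [Fin.lt_def] at hx
      rw [Fin.ext_iff]; omega
    · subst hx
      rw [h] at *
      rw [Fin.ext_iff]; omega
  have n4 : w M' ≠ M := by
    intro h
    apply hQ
    apply peelR M ⟨hM1, M.2⟩
    apply Stb_of_fix_ge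
    intro x hx
    rw [Equiv.Perm.mul_apply]
    have e := simpleT_val (n := n) (j := M) ⟨hM1, M.2⟩ x
    rcases lt_or_eq_of_le (show M ≤ x by rw [Fin.le_def]; omega) with hx | hx
    · have : simpleT n M x = x := by
        rw [Fin.lt_def] at hx
        rw [Fin.ext_iff]; omega
      rw [this, hmax x hx]
    · subst hx
      have : simpleT n M M = M' := by
        rw [Fin.ext_iff]; omega
      rw [this, h]
  obtain ⟨q', hq'⟩ := w.surjective m'
  obtain ⟨p', hp'⟩ := w.surjective M'
  have lt_m' : ∀ x : Fin n, m < x → x ≠ m' → m' < x := by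
    intro x h1 h2
    rw [Fin.lt_def] at *
    rw [Ne, Fin.ext_iff] at h2
    omega
  have lt_M' : ∀ x : Fin n, x < M → x ≠ M' → x < M' := by
    intro x h1 h2
    rw [Fin.lt_def] at *
    rw [Ne, Fin.ext_iff] at h2
    omega
  have hmm' : m < m' := by rw [Fin.lt_def]; omega
  have hMM' : M' < M := by rw [Fin.lt_def]; omega
  have low : ∀ x, m < x → m < w x ∨ x = q := by
    intro x hx
    rcases lt_trichotomy (w x) m with h | h | h
    · exact absurd ((hinj _ _ (hmin _ h)) ▸ h) (not_lt.2 hx.le)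
    · right; exact hinj _ _ (h.trans hq.symm)
    · left; exact h
  have high : ∀ x, x < M → w x < M ∨ x = p := by
    intro x hx
    rcases lt_trichotomy (w x) M with h | h | h
    · left; exact h
    · right; exact hinj _ _ (h.trans hp.symm)
    · exact absurd ((hinj _ _ (hmax _ h)) ▸ h) (not_lt.2 hx.le)
  -- between m and q everything is above w m
  have btw : ∀ x, m < x → x < q → w m < w x := by
    intro x h1 h2
    rcases low x h1 with h | h
    · rcases lt_trichotomy (w x) (w m) with g | g | g
      · exact (h3 m x q h1 h2 (by rw [hq]; exact h) g).elim
      · exact absurd (hinj _ _ g) h1.ne'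
      · exact g
    · exact absurd h h2.ne
  have btw2 : ∀ x, p < x → x < M → w x < w M := by
    intro x h1 h2
    rcases high x h2 with h | h
    · rcases lt_trichotomy (w x) (w M) with g | g | g
      · exact g
      · exact absurd (hinj _ _ g) h2.ne
      · exact (h3 p x M h1 h2 g (by rw [hp]; exact h)).elim
    · exact absurd h h1.ne'
  have hm'q : m' < q := lt_m' q hmq (by rintro rfl; exact n2 hq)
  have hm'w : m' < w m := lt_m' _ hwm n1
  have hpM' : p < M' := lt_M' p hpM (by rintro rfl; exact n4 hp)
  have hwM' : w M < M' := lt_M' _ hwM n3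
  have hqq' : q < q' := by
    rcases lt_trichotomy q q' with h | h | h
    · exact h
    · subst h; exact absurd (hq.symm.trans hq') hmm'.ne
    · rcases lt_trichotomy q' m with g | g | g
      · have := hmin _ g
        rw [hq'] at this
        rw [← this] at g
        exact absurd g (not_lt.2 hmm'.le)
      · subst g; exact absurd hq' n1
      · have := btw q' g h
        rw [hq'] at this
        exact absurd this (not_lt.2 hm'w.le)
  have hpp' : p' < p := by
    rcases lt_trichotomy p' p with h | h | h
    · exact h
    · subst h; exact absurd (hp.symm.trans hp') hMM'.ne'
    · rcases lt_trichotomy p' M with g | g | g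
      · have := btw2 p' h g
        rw [hp'] at this
        exact absurd this (not_lt.2 hwM'.le)
      · subst g; exact absurd hp' n3
      · have := hmax _ g
        rw [hp'] at this
        rw [← this] at g
        exact absurd g (not_lt.2 hMM'.le)
  have o1 : Occ4 w m m' q q' :=
    ⟨hmm', hm'q, hqq', by rw [hq, hq']; exact hmm', by rw [hq']; exact hm'w, btw _ hmm' hm'q⟩
  have o2 : Occ4 w p' p M' M :=
    ⟨hpp', hpM', hMM', btw2 _ hpM' hMM', by rw [hp']; exact hwM', by rw [hp', hp]; exact hMM'⟩
  obtain ⟨r1, r2, r3, r4⟩ := hu _ _ _ _ o1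
  obtain ⟨t1, t2, t3, t4⟩ := hu _ _ _ _ o2
  have u1 : p' = m := t1.trans r1.symm
  have u2 : p = m' := t2.trans r2.symm
  have u3 : q = M' := r3.trans t3.symm
  have u4 : q' = M := r4.trans t4.symm
  have hM3 : (M : ℕ) = m + 3 := by
    by_contra hc
    have hx : (m' : ℕ) + 1 < n := by have := q.2; rw [Fin.lt_def] at hm'q; omega
    have l1 : m' < (⟨m' + 1, hx⟩ : Fin n) := by rw [Fin.lt_def]; simp
    have l2 : (⟨m' + 1, hx⟩ : Fin n) < q := by
      rw [u3] at hm'q ⊢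
      rw [Fin.lt_def] at hm'q ⊢
      simp only
      omega
    have l3 := btw _ (hmm'.trans l1) l2
    rw [← u1, hp'] at l3
    rcases high _ ((l2.trans hqq').trans_eq u4) with h | h
    · rw [Fin.lt_def] at l3 h
      omega
    · rw [u2] at h
      exact absurd h l1.ne'
  apply hQ
  have hb1 : 1 ≤ (m : ℕ) + 1 := by omega
  have hb2 : (m : ℕ) + 1 + 2 < n := by have := M.2; omega
  refine ⟨[], [], m + 1, ⟨?_, by simp, by simp, by simp, by simp⟩, ?_⟩
  · intro j hj
    simp [FF] at hj
    omega
  · simp only [List.nil_append, List.append_nil]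
    ext x
    have e := FF_val hb1 hb2 x
    subst u1 u2 u3 u4
    have c1 : x = p' ∨ x = p ∨ x = q ∨ x = q' ∨ x < p' ∨ q' < x := by
      simp only [Fin.lt_def, Fin.ext_iff]
      omega
    rcases c1 with rfl | rfl | rfl | rfl | g | g
    · rw [hp']; omega
    · rw [hp]; omega
    · rw [hq]; omega
    · rw [hq']; omega
    · rw [hmin x g]; rw [Fin.lt_def] at g; omega
    · rw [hmax x g]; rw [Fin.lt_def] at g; omega

/-- `w` contains the pattern 3412 exactly once and avoids 321 iff some
reduced decomposition of `w` contains a factor `sᵢ₊₁ sᵢ sᵢ₊₂ sᵢ₊₁` in which the letter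
`i + 1` occurs exactly twice and every other letter occurs exactly once. -/
theorem stmt1 (n : ℕ) (hn : 1 ≤ n) (w : Equiv.Perm (Fin n)) :
    (ContainsPatternOnce w pattern3412 ∧ AvoidsPattern w pattern321) ↔
      ∃ word : List ℕ, IsReducedWord n word w ∧
        ∃ (a b : List ℕ) (i : ℕ), word = a ++ [i + 1, i, i + 2, i + 1] ++ b ∧
          word.count (i + 1) = 2 ∧ ∀ j : ℕ, j ≠ i + 1 → j ∈ word → word.count j = 1 := by
  rw [PP_iff]
  constructor
  · intro h
    obtain ⟨a, b, i, hg, hw⟩ := main_fwd n _ w rfl h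
    refine ⟨a ++ FF i ++ b, hw ▸ hg.reduced, a, b, i, rfl, ?_, ?_⟩
    · obtain ⟨_, _, _, h1, _⟩ := hg
      rw [← List.count_eq_zero, List.count_append] at h1
      rw [List.count_append, List.count_append]
      have : (FF i).count (i + 1) = 2 := by simp [FF, List.count_cons]
      omega
    · intro j hj hjm
      obtain ⟨_, hnd, h0, h1, h2⟩ := hg
      have e : (a ++ b).count j ≤ 1 := List.nodup_iff_count_le_one.1 hnd j
      have p : 0 < (a ++ FF i ++ b).count j := List.count_pos_iff.2 hjm
      rw [← List.count_eq_zero, List.count_append] at h0 h1 h2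
      simp only [List.count_append] at *
      by_cases hf : j ∈ FF i
      · simp only [FF, List.mem_cons, List.not_mem_nil, or_false] at hf
        rcases hf with rfl | rfl | rfl | rfl
        · exact absurd rfl hj
        · have : (FF j).count j = 1 := by simp [FF, List.count_cons]
          omega
        · have : (FF i).count (i + 2) = 1 := by simp [FF, List.count_cons]
          omega
        · exact absurd rfl hj
      · have := List.count_eq_zero.2 hf
        omega
  · rintro ⟨word, hr, a, b, i, hw, hc, hj⟩
    have hv := reduced_valid hr
    subst hw
    have hr1 : ((a ++ FF i ++ b).map (simpleT n)).prod = w := hr.1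
    rw [← hr1]
    apply GoodW.PP
    have c0 : (FF i).count i = 1 := by simp [FF, List.count_cons]
    have c1 : (FF i).count (i + 1) = 2 := by simp [FF, List.count_cons]
    have c2 : (FF i).count (i + 2) = 1 := by simp [FF, List.count_cons]
    have j0 := hj i (by omega) (by simp)
    have j2 := hj (i + 2) (by omega) (by simp)
    change (a ++ FF i ++ b).count (i + 1) = 2 at hc
    change (a ++ FF i ++ b).count i = 1 at j0
    change (a ++ FF i ++ b).count (i + 2) = 1 at j2
    simp only [List.count_append] at hc j0 j2
    refine ⟨hv, ?_, ?_, ?_, ?_⟩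
    · rw [List.nodup_iff_count_le_one]
      intro k
      by_cases hk : k ∈ a ++ b
      · by_cases hk1 : k = i + 1
        · subst hk1
          rw [List.count_append]; omega
        · have := hj k hk1 (by simp at hk ⊢; tauto)
          simp only [List.count_append] at this ⊢
          omega
      · rw [List.count_eq_zero.2 hk]; omega
    · rw [← List.count_eq_zero, List.count_append]; omega
    · rw [← List.count_eq_zero, List.count_append]; omega
    · rw [← List.count_eq_zero, List.count_append]; omega
end

section
/- Let w be a permutation in S_n that avoids the patterns 3412 and 4231. Then ℓ(w) − |supp(w)| is at most the number of occurrences of the pattern 321 in w, and equality holds if and only if w avoids the pattern 4321. -/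
open Finset in
def invF {n : ℕ} (w : Equiv.Perm (Fin n)) : Finset (Fin n × Fin n) :=
  univ.filter (fun p => p.1 < p.2 ∧ w p.2 < w p.1)

lemma mem_invF {n : ℕ} (w : Equiv.Perm (Fin n)) (a b : Fin n) :
    (a, b) ∈ invF w ↔ a < b ∧ w b < w a := by simp [invF]

lemma swap_adj_val {n : ℕ} (a b x : Fin n) (hab : b.val = a.val + 1) :
    (Equiv.swap a b x).val = if x.val = a.val then b.val else if x.val = b.val then a.val else x.val := by
  rw [Equiv.swap_apply_def]
  split_ifs <;> simp_all [Fin.ext_iff]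

lemma invF_asc {n : ℕ} (w : Equiv.Perm (Fin n)) (a b : Fin n) (hab : b.val = a.val + 1)
    (h : w a < w b) : (invF (w * Equiv.swap a b)).card = (invF w).card + 1 := by
  have hne : (a, b) ∉ (invF w).image (Prod.map (Equiv.swap a b) (Equiv.swap a b)) := by
    intro hm
    rw [Finset.mem_image] at hm
    obtain ⟨⟨x, y⟩, hxy, he⟩ := hm
    rw [mem_invF] at hxy
    simp only [Prod.map, Prod.mk.injEq] at he
    have h1 : x = b := by
      have := congrArg (Equiv.swap a b) he.1
      simpa using this
    have h2 : y = a := by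
      have := congrArg (Equiv.swap a b) he.2
      simpa using this
    subst h1 h2
    have := hxy.1
    simp only [Fin.lt_def] at this
    omega
  have hcard : ((invF w).image (Prod.map (Equiv.swap a b) (Equiv.swap a b))).card = (invF w).card :=
    Finset.card_image_of_injective _
      (Function.Injective.prodMap (Equiv.injective _) (Equiv.injective _))
  have heq : invF (w * Equiv.swap a b)
      = insert (a, b) ((invF w).image (Prod.map (Equiv.swap a b) (Equiv.swap a b))) := by
    ext ⟨x, y⟩
    rw [mem_invF, Finset.mem_insert, Finset.mem_image]
    constructor
    · rintro ⟨hxy, hw⟩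
      by_cases hc : x = a ∧ y = b
      · left; simp [hc]
      · right
        refine ⟨(Equiv.swap a b x, Equiv.swap a b y), ?_, by simp [Prod.map]⟩
        rw [mem_invF]
        refine ⟨?_, hw⟩
        have e1 := swap_adj_val a b x hab
        have e2 := swap_adj_val a b y hab
        rw [Fin.lt_def] at hxy ⊢
        rw [Fin.ext_iff, Fin.ext_iff] at hc
        rw [e1, e2]
        split_ifs <;> omega
    · rintro (hc | ⟨⟨x', y'⟩, hm, he⟩)
      · simp only [Prod.mk.injEq] at hc
        obtain ⟨rfl, rfl⟩ := hc
        refine ⟨by rw [Fin.lt_def]; omega, by simpa using h⟩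
      · simp only [Prod.map, Prod.mk.injEq] at he
        obtain ⟨rfl, rfl⟩ := he
        rw [mem_invF] at hm
        refine ⟨?_, by simpa using hm.2⟩
        have hc : ¬ (x' = a ∧ y' = b) := by
          rintro ⟨rfl, rfl⟩
          exact absurd h (not_lt.2 hm.2.le)
        have e1 := swap_adj_val a b x' hab
        have e2 := swap_adj_val a b y' hab
        have h1 := hm.1
        rw [Fin.lt_def] at h1 ⊢
        rw [Fin.ext_iff, Fin.ext_iff] at hc
        rw [e1, e2]
        split_ifs <;> omega
  rw [heq, Finset.card_insert_of_notMem hne, hcard]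

lemma invF_desc {n : ℕ} (w : Equiv.Perm (Fin n)) (a b : Fin n) (hab : b.val = a.val + 1)
    (h : w b < w a) : (invF w).card = (invF (w * Equiv.swap a b)).card + 1 := by
  have := invF_asc (w * Equiv.swap a b) a b hab (by simpa using h)
  rw [← this, mul_assoc, Equiv.swap_mul_self, mul_one]

lemma invF_simple_le {n : ℕ} (w : Equiv.Perm (Fin n)) (j : ℕ) :
    (invF (w * simpleT n j)).card ≤ (invF w).card + 1 := by
  unfold simpleT
  split_ifs with h
  · have hab : (⟨j, h.2⟩ : Fin n).val = (⟨j - 1, by omega⟩ : Fin n).val + 1 := by simp; omega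
    rcases lt_trichotomy (w ⟨j - 1, by omega⟩) (w ⟨j, h.2⟩) with h' | h' | h'
    · exact (invF_asc w _ _ hab h').le
    · have := w.injective h'
      simp at this
      omega
    · have := invF_desc w _ _ hab h'
      omega
  · simp

lemma invF_one (n : ℕ) : invF (1 : Equiv.Perm (Fin n)) = ∅ := by
  ext ⟨a, b⟩
  rw [mem_invF]
  simp
  intro h; exact h.le

lemma invF_word_le (n : ℕ) (l : List ℕ) :
    (invF ((l.map (simpleT n)).prod)).card ≤ l.length := by
  induction l using List.reverseRecOn with
  | nil => simp [invF_one]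
  | append_singleton l j ih =>
    have := invF_simple_le ((l.map (simpleT n)).prod) j
    simp only [List.map_append, List.prod_append, List.map_cons, List.map_nil, List.prod_singleton,
      List.length_append, List.length_singleton]
    omega

lemma exists_desc {n : ℕ} (w : Equiv.Perm (Fin n)) (hw : w ≠ 1) :
    ∃ a b : Fin n, b.val = a.val + 1 ∧ w b < w a := by
  by_contra hcon
  push Not at hcon
  apply hw
  have hm : StrictMono w := by
    cases n with
    | zero => intro a; exact a.elim0
    | succ m =>
      rw [Fin.strictMono_iff_lt_succ]
      intro i
      refine lt_of_le_of_ne (hcon _ _ (by simp)) ?_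
      intro h
      have := w.injective h
      simp [Fin.ext_iff] at this
  have := Subsingleton.elim (hm.orderIsoOfSurjective w w.surjective) (OrderIso.refl _)
  ext x
  have := congrArg (fun f => f x) this
  simpa [Fin.ext_iff] using this

lemma exists_word (n : ℕ) : ∀ (k : ℕ) (w : Equiv.Perm (Fin n)), (invF w).card = k →
    ∃ l : List ℕ, l.length = k ∧ (l.map (simpleT n)).prod = w := by
  intro k
  induction k with
  | zero =>
    intro w hk
    refine ⟨[], rfl, ?_⟩
    by_contra hw
    obtain ⟨a, b, hab, h⟩ := exists_desc w (fun h => hw (by simp [h]))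
    have := invF_desc w a b hab h
    omega
  | succ k ih =>
    intro w hk
    have hw : w ≠ 1 := by
      rintro rfl
      simp [invF_one] at hk
    obtain ⟨a, b, hab, h⟩ := exists_desc w hw
    have := invF_desc w a b hab h
    obtain ⟨l, hl, hp⟩ := ih (w * Equiv.swap a b) (by omega)
    refine ⟨l ++ [b.val], by simp [hl], ?_⟩
    have hs : simpleT n b.val = Equiv.swap a b := by
      unfold simpleT
      rw [dif_pos ⟨by omega, b.2⟩]
      congr 1
      ext; simp; omega
    simp [hp, hs, mul_assoc]

lemma permLen_eq (n : ℕ) (w : Equiv.Perm (Fin n)) : permLen n w = (invF w).card := by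
  apply le_antisymm
  · exact Nat.sInf_le (exists_word n _ w rfl)
  · obtain ⟨l, hl, hp⟩ := Nat.sInf_mem (s := {l : ℕ | ∃ word : List ℕ, word.length = l ∧
      (word.map (simpleT n)).prod = w}) ⟨_, exists_word n _ w rfl⟩
    unfold permLen
    rw [← hl, ← hp]
    exact invF_word_le n l

lemma supp_step {n : ℕ} (u : Equiv.Perm (Fin n)) (a b : Fin n) (hab : b.val = a.val + 1)
    (h : u a < u b) (i : ℕ) :
    (∃ x y : Fin n, x.val < i ∧ i ≤ y.val ∧ (u * Equiv.swap a b) y < (u * Equiv.swap a b) x) ↔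
    ((∃ x y : Fin n, x.val < i ∧ i ≤ y.val ∧ u y < u x) ∨ i = b.val) := by
  by_cases hi : i = b.val
  · simp only [hi, or_true, iff_true]
    exact ⟨a, b, by omega, le_rfl, by simpa using h⟩
  · simp only [hi, or_false]
    have hs : ∀ x : Fin n, ((Equiv.swap a b x).val < i ↔ x.val < i) := by
      intro x
      rw [swap_adj_val a b x hab]
      split_ifs <;> omega
    constructor
    · rintro ⟨x, y, hx, hy, hu⟩
      refine ⟨Equiv.swap a b x, Equiv.swap a b y, (hs x).2 hx, ?_, hu⟩
      have := hs y
      omega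
    · rintro ⟨x, y, hx, hy, hu⟩
      refine ⟨Equiv.swap a b x, Equiv.swap a b y, (hs x).2 hx, ?_, by simpa using hu⟩
      have := hs y
      omega

lemma word_supp (n : ℕ) (l : List ℕ) :
    (invF ((l.map (simpleT n)).prod)).card = l.length → ∀ i, (i ∈ l ↔
      ∃ x y : Fin n, x.val < i ∧ i ≤ y.val ∧
        ((l.map (simpleT n)).prod) y < ((l.map (simpleT n)).prod) x) := by
  induction l using List.reverseRecOn with
  | nil =>
    intro _ i
    simp only [List.not_mem_nil, List.map_nil, List.prod_nil, Equiv.Perm.one_apply, false_iff]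
    rintro ⟨x, y, h1, h2, h3⟩
    rw [Fin.lt_def] at h3
    omega
  | append_singleton l j ih =>
    simp only [List.map_append, List.prod_append, List.map_cons, List.map_nil, List.prod_singleton,
      List.length_append, List.length_singleton]
    intro hc i
    have hle := invF_word_le n l
    generalize (l.map (simpleT n)).prod = u at *
    by_cases hj : 1 ≤ j ∧ j < n
    · have hab : (⟨j, hj.2⟩ : Fin n).val = (⟨j - 1, by omega⟩ : Fin n).val + 1 := by simp; omega
      have hs : simpleT n j = Equiv.swap ⟨j - 1, by omega⟩ ⟨j, hj.2⟩ := by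
        unfold simpleT; rw [dif_pos hj]
      rw [hs] at hc ⊢
      rcases lt_trichotomy (u ⟨j - 1, by omega⟩) (u ⟨j, hj.2⟩) with h' | h' | h'
      · have h2 := invF_asc u _ _ hab h'
        rw [supp_step u _ _ hab h', ← ih (by omega)]
        simp
      · have := u.injective h'
        simp at this
        omega
      · have := invF_desc u _ _ hab h'
        omega
    · have hs : simpleT n j = 1 := by
        unfold simpleT; rw [dif_neg hj]
      rw [hs, mul_one] at hc
      omega

lemma permSupp_eq (n : ℕ) (w : Equiv.Perm (Fin n)) :
    permSupp n w = {i | ∃ x y : Fin n, x.val < i ∧ i ≤ y.val ∧ w y < w x} := by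
  ext i
  simp only [permSupp, IsReducedWord, Set.mem_ofPred_eq, permLen_eq]
  constructor
  · rintro ⟨l, ⟨rfl, hl⟩, hi⟩
    exact (word_supp n l hl.symm i).1 hi
  · intro h
    obtain ⟨l, hl, rfl⟩ := exists_word n _ w rfl
    exact ⟨l, ⟨rfl, hl⟩, (word_supp n l hl.symm i).2 h⟩

open Finset in
def nonStart {n : ℕ} (w : Equiv.Perm (Fin n)) (v : ℕ) : Finset (Fin n) :=
  univ.filter (fun p => (w p).val < v ∧ ∃ x y : Fin n, x < p ∧ p ≤ y ∧ (w x).val < v ∧ w y < w x)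

open Finset in
def coverF {n : ℕ} (w : Equiv.Perm (Fin n)) (d : Fin n) : Finset (Fin n) :=
  univ.filter (fun p => d < p ∧ w p < w d ∧ ∀ c, d < c → c < p → w p < w c → w d < w c)

lemma mem_nonStart {n : ℕ} (w : Equiv.Perm (Fin n)) (v : ℕ) (p : Fin n) : p ∈ nonStart w v ↔
    (w p).val < v ∧ ∃ x y : Fin n, x < p ∧ p ≤ y ∧ (w x).val < v ∧ w y < w x := by
  simp [nonStart]

lemma mem_coverF {n : ℕ} (w : Equiv.Perm (Fin n)) (d p : Fin n) : p ∈ coverF w d ↔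
    d < p ∧ w p < w d ∧ ∀ c, d < c → c < p → w p < w c → w d < w c := by
  simp [coverF]

/-- elementwise pattern avoidance -/
def Av3412 {n : ℕ} (w : Equiv.Perm (Fin n)) : Prop :=
  ∀ a b c d : Fin n, a < b → b < c → c < d → w c < w d → w d < w a → w a < w b → False

def Av4231 {n : ℕ} (w : Equiv.Perm (Fin n)) : Prop :=
  ∀ a b c d : Fin n, a < b → b < c → c < d → w d < w b → w b < w c → w c < w a → False

lemma wne {n : ℕ} (w : Equiv.Perm (Fin n)) {a b : Fin n} (h : a ≠ b) : w a ≠ w b :=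
  fun e => h (w.injective e)

/-- two covers: the later one is a block start -/
lemma key {n : ℕ} (w : Equiv.Perm (Fin n)) (h1 : Av3412 w) (h2 : Av4231 w) (d p q : Fin n)
    (hp : p ∈ coverF w d) (hq : q ∈ coverF w d) (hpq : p < q) : q ∉ nonStart w (w d).val := by
  rw [mem_coverF] at hp hq
  rw [mem_nonStart]
  rintro ⟨_, x, y, hx, hy, hxv, hyx⟩
  obtain ⟨hdp, hwp, hpc⟩ := hp
  obtain ⟨hdq, hwq, hqc⟩ := hq
  replace hxv : w x < w d := hxv
  have hpq' : w p < w q := by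
    rcases lt_trichotomy (w p) (w q) with h | h | h
    · exact h
    · exact absurd (w.injective h) hpq.ne
    · exact absurd (hqc p hdp hpq h) (not_lt.2 hwp.le)
  have hyp : w p < w y := by
    by_contra hc
    have hc' : w y < w p := lt_of_le_of_ne (not_lt.1 hc) (wne w (hpq.trans_le hy).ne')
    have hqy : q < y := lt_of_le_of_ne hy (by rintro rfl; exact absurd hc' (not_lt.2 hpq'.le))
    exact h2 d p q y hdp hpq hqy hc' hpq' hwq
  rcases lt_trichotomy x d with hxd | hxd | hxd
  · exact h1 x d p y hxd hdp (hpq.trans_le hy) hyp hyx hxv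
  · subst hxd; exact lt_irrefl _ hxv
  · -- x in the tail
    have hxq : w x < w q := by
      by_contra hc
      have hc' : w q < w x := lt_of_le_of_ne (not_lt.1 hc) (wne w hx.ne')
      exact absurd (hqc x hxd hx hc') (not_lt.2 hxv.le)
    have hqy : q < y := lt_of_le_of_ne hy (by rintro rfl; exact absurd hyx (not_lt.2 hxq.le))
    exact h2 d x q y hxd hx hqy hyx hxq hwq

lemma nonStart_mono {n : ℕ} (w : Equiv.Perm (Fin n)) (v : ℕ) :
    nonStart w v ⊆ nonStart w (v + 1) := by
  intro p
  rw [mem_nonStart, mem_nonStart]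
  rintro ⟨h, x, y, hx, hy, hxv, hyx⟩
  exact ⟨by omega, x, y, hx, hy, by omega, hyx⟩

lemma nonStart_d {n : ℕ} (w : Equiv.Perm (Fin n)) (d p : Fin n) (hp : p ∈ coverF w d)
    (hfirst : ∀ c, d < c → c < p → w d < w c) :
    d ∈ nonStart w ((w d).val + 1) ↔ p ∈ nonStart w (w d).val := by
  rw [mem_coverF] at hp
  obtain ⟨hdp, hwp, hpc⟩ := hp
  rw [mem_nonStart, mem_nonStart]
  constructor
  · rintro ⟨_, x, y, hx, hy, hxv, hyx⟩
    have hxd : w x < w d := lt_of_le_of_ne (by rw [Fin.le_def]; omega) (wne w hx.ne)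
    refine ⟨hwp, x, y, hx.trans hdp, ?_, hxd, hyx⟩
    by_contra hc
    have hdy : d < y := lt_of_le_of_ne hy (by rintro rfl; exact absurd hyx (not_lt.2 hxd.le))
    exact absurd (hfirst y hdy (not_le.1 hc)) (not_lt.2 (hyx.trans hxd).le)
  · rintro ⟨_, x, y, hx, hy, hxv, hyx⟩
    replace hxv : w x < w d := hxv
    refine ⟨by omega, x, y, ?_, (hdp.le.trans hy), by rw [Fin.lt_def] at hxv; omega, hyx⟩
    by_contra hc
    have hdx : d < x := lt_of_le_of_ne (not_lt.1 hc) (by rintro rfl; exact lt_irrefl _ hxv)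
    exact absurd (hfirst x hdx hx) (not_lt.2 hxv.le)

lemma exists_first {n : ℕ} (w : Equiv.Perm (Fin n)) (d y : Fin n) (hy : d < y) (hw : w y < w d) :
    ∃ p, p ∈ coverF w d ∧ ∀ c, d < c → c < p → w d < w c := by
  obtain ⟨p, hp, hmin⟩ := WellFounded.has_min (wellFounded_lt (α := Fin n))
    {p : Fin n | d < p ∧ w p < w d} ⟨y, hy, hw⟩
  have hf : ∀ c, d < c → c < p → w d < w c := by
    intro c hc hcp
    by_contra hcon
    exact hmin c ⟨hc, lt_of_le_of_ne (not_lt.1 hcon) (wne w hc.ne')⟩ hcp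
  exact ⟨p, (mem_coverF _ _ _).2 ⟨hp.1, hp.2, fun c h1 h2 _ => hf c h1 h2⟩, hf⟩

lemma nonStart_card_step {n : ℕ} (w : Equiv.Perm (Fin n)) (h1 : Av3412 w) (h2 : Av4231 w)
    (d : Fin n) :
    (nonStart w ((w d).val + 1)).card = (nonStart w (w d).val).card + (coverF w d).card := by
  classical
  have hsd := Finset.card_sdiff_add_card_eq_card (nonStart_mono w (w d).val)
  suffices h : (coverF w d).card = (nonStart w ((w d).val + 1) \ nonStart w (w d).val).card by omega
  have hdn : d ∉ nonStart w (w d).val := by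
    rw [mem_nonStart]; rintro ⟨h, _⟩; omega
  -- uniqueness: members of both coverF and nonStart are the first
  have huniq : ∀ p, p ∈ coverF w d → p ∈ nonStart w (w d).val →
      ∀ c, d < c → c < p → w d < w c := by
    intro p hp hpn c hdc hcp
    by_contra hcon
    obtain ⟨p', hp', hf⟩ := exists_first w d c hdc
      (lt_of_le_of_ne (not_lt.1 hcon) (wne w hdc.ne'))
    have : p' < p := by
      refine lt_of_le_of_lt ?_ hcp
      by_contra hh
      exact hcon (hf c hdc (not_le.1 hh))
    exact key w h1 h2 d p' p hp' hp this hpn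
  apply Finset.card_bij (fun p _ => if p ∈ nonStart w (w d).val then d else p)
  · intro p hp
    split_ifs with hpn
    · rw [Finset.mem_sdiff]
      exact ⟨(nonStart_d w d p hp (huniq p hp hpn)).2 hpn, hdn⟩
    · rw [Finset.mem_sdiff]
      refine ⟨?_, hpn⟩
      rw [mem_coverF] at hp
      rw [mem_nonStart]
      refine ⟨?_, d, p, hp.1, le_rfl, by omega, hp.2.1⟩
      have := hp.2.1
      rw [Fin.lt_def] at this
      omega
  · intro p hp q hq he
    have hdp := ((mem_coverF _ _ _).1 hp).1
    have hdq := ((mem_coverF _ _ _).1 hq).1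
    split_ifs at he with ha hb hb
    · by_contra hne
      rcases lt_or_gt_of_ne hne with h | h
      · exact key w h1 h2 d p q hp hq h hb
      · exact key w h1 h2 d q p hq hp h ha
    · exact absurd he hdq.ne
    · exact absurd he hdp.ne'
    · exact he
  · intro p hp
    rw [Finset.mem_sdiff] at hp
    obtain ⟨hp, hpn⟩ := hp
    have hp' := hp
    rw [mem_nonStart] at hp
    obtain ⟨hwp, x, y, hx, hy, hxv, hyx⟩ := hp
    rcases lt_trichotomy p d with hpd | hpd | hpd
    · exfalso
      apply hpn
      rw [mem_nonStart]
      have h3 := wne w hpd.ne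
      have h4 := wne w (hx.trans hpd).ne
      rw [Ne, Fin.ext_iff] at h3 h4
      exact ⟨by omega, x, y, hx, hy, by omega, hyx⟩
    · subst hpd
      have hxp := wne w hx.ne
      have hyp : w y < w p := by
        refine lt_of_lt_of_le hyx ?_
        rw [Fin.le_def]; omega
      have hpy : p < y := lt_of_le_of_ne hy (by rintro rfl; exact lt_irrefl _ hyp)
      obtain ⟨q, hq, hf⟩ := exists_first w p y hpy hyp
      refine ⟨q, hq, ?_⟩
      rw [if_pos ((nonStart_d w p q hq hf).1 hp')]
    · have h3 := wne w hpd.ne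
      rw [Ne, Fin.ext_iff] at h3
      have hwpd : w p < w d := by rw [Fin.lt_def]; omega
      refine ⟨p, ?_, by rw [if_neg hpn]⟩
      rw [mem_coverF]
      refine ⟨hpd, hwpd, ?_⟩
      intro c hdc hcp hpc
      by_contra hcon
      apply hpn
      rw [mem_nonStart]
      have hcd : w c < w d := lt_of_le_of_ne (not_lt.1 hcon) (wne w hdc.ne')
      exact ⟨hwpd, c, p, hcp, le_rfl, hcd, hpc⟩

lemma nonStart_card {n : ℕ} (w : Equiv.Perm (Fin n)) (h1 : Av3412 w) (h2 : Av4231 w) :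
    (nonStart w n).card = ∑ d : Fin n, (coverF w d).card := by
  have hgen : ∀ v, v ≤ n → (nonStart w v).card =
      ∑ i ∈ Finset.range v, if h : i < n then (coverF w (w.symm ⟨i, h⟩)).card else 0 := by
    intro v
    induction v with
    | zero => intro _; simp [nonStart]
    | succ v ih =>
      intro hv
      rw [Finset.sum_range_succ, ← ih (by omega), dif_pos (by omega : v < n)]
      have := nonStart_card_step w h1 h2 (w.symm ⟨v, by omega⟩)
      simpa using this
  rw [hgen n le_rfl, Finset.sum_range]
  simp only [Fin.is_lt, dite_true, Fin.eta]
  exact Equiv.sum_comp w.symm (fun d => (coverF w d).card)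

open Finset in
def coverPairs {n : ℕ} (w : Equiv.Perm (Fin n)) : Finset (Fin n × Fin n) :=
  univ.filter (fun p => p.2 ∈ coverF w p.1)

lemma coverPairs_card {n : ℕ} (w : Equiv.Perm (Fin n)) :
    (coverPairs w).card = ∑ d : Fin n, (coverF w d).card := by
  have : coverPairs w = (Finset.univ.sigma (fun d => coverF w d)).map
      (Equiv.sigmaEquivProd (Fin n) (Fin n)).toEmbedding := by
    ext ⟨a, b⟩
    simp [coverPairs]
  rw [this, Finset.card_map, Finset.card_sigma]

lemma supp_card {n : ℕ} (w : Equiv.Perm (Fin n)) (h1 : Av3412 w) (h2 : Av4231 w) :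
    (permSupp n w).ncard = (coverPairs w).card := by
  rw [coverPairs_card, ← nonStart_card w h1 h2, permSupp_eq]
  have : {i | ∃ x y : Fin n, x.val < i ∧ i ≤ y.val ∧ w y < w x}
      = (((nonStart w n).map Fin.valEmbedding : Finset ℕ) : Set ℕ) := by
    ext i
    simp only [Set.mem_ofPred_eq, Finset.coe_map, Set.mem_image, Finset.mem_coe, mem_nonStart]
    constructor
    · rintro ⟨x, y, hx, hy, h⟩
      exact ⟨⟨i, by omega⟩, ⟨Fin.is_lt _, x, y, hx, hy, Fin.is_lt _, h⟩, rfl⟩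
    · rintro ⟨p, ⟨_, x, y, hx, hy, _, h⟩, rfl⟩
      exact ⟨x, y, hx, hy, h⟩
  rw [this, Set.ncard_coe_finset, Finset.card_map]

open Finset in
def tripF {n : ℕ} (w : Equiv.Perm (Fin n)) : Finset (Fin n × Fin n × Fin n) :=
  univ.filter (fun t => t.1 < t.2.1 ∧ t.2.1 < t.2.2 ∧ w t.2.2 < w t.2.1 ∧ w t.2.1 < w t.1)

lemma mem_tripF {n : ℕ} (w : Equiv.Perm (Fin n)) (a b c : Fin n) : (a, b, c) ∈ tripF w ↔
    a < b ∧ b < c ∧ w c < w b ∧ w b < w a := by simp [tripF]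

lemma numOcc_eq {n : ℕ} (w : Equiv.Perm (Fin n)) : numOcc w pattern321 = (tripF w).card := by
  unfold numOcc
  rw [← Set.ncard_coe_finset]
  apply Set.ncard_congr (fun j _ => (j 0, j 1, j 2))
  · rintro j ⟨hm, hj⟩
    rw [Finset.mem_coe, mem_tripF]
    exact ⟨hm (by decide), hm (by decide), (hj 2 1).2 (by decide), (hj 1 0).2 (by decide)⟩
  · intro j k _ _ h
    simp only [Prod.mk.injEq] at h
    ext i
    fin_cases i <;> simp [h]
  · rintro ⟨a, b, c⟩ h
    rw [Finset.mem_coe, mem_tripF] at h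
    obtain ⟨h1, h2, h3, h4⟩ := h
    refine ⟨![a, b, c], ⟨?_, ?_⟩, rfl⟩
    · rw [Fin.strictMono_iff_lt_succ]
      intro i
      fin_cases i <;> simpa
    · intro i k
      have : w c < w a := h3.trans h4
      fin_cases i <;> fin_cases k <;>
        simp [pattern321, Equiv.swap_apply_def, h3, h4, this, h3.le, h4.le, this.le]

lemma contains4 {n : ℕ} (w : Equiv.Perm (Fin n)) (p : Equiv.Perm (Fin 4)) (a b c d : Fin n)
    (hab : a < b) (hbc : b < c) (hcd : c < d)
    (h : StrictMono (fun i => w (![a, b, c, d] (p.symm i)))) : ContainsPattern w p := by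
  refine ⟨![a, b, c, d], ?_, ?_⟩
  · rw [Fin.strictMono_iff_lt_succ]
    intro i
    fin_cases i <;> simpa
  · intro i k
    have := h.lt_iff_lt (a := p i) (b := p k)
    simpa using this

lemma av3412 {n : ℕ} (w : Equiv.Perm (Fin n)) (h : AvoidsPattern w pattern3412) : Av3412 w := by
  intro a b c d hab hbc hcd h1 h2 h3
  apply h
  apply contains4 w _ a b c d hab hbc hcd
  rw [Fin.strictMono_iff_lt_succ]
  intro i
  fin_cases i
  · exact h1
  · exact h2
  · exact h3

lemma av4231 {n : ℕ} (w : Equiv.Perm (Fin n)) (h : AvoidsPattern w pattern4231) : Av4231 w := by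
  intro a b c d hab hbc hcd h1 h2 h3
  apply h
  apply contains4 w _ a b c d hab hbc hcd
  rw [Fin.strictMono_iff_lt_succ]
  intro i
  fin_cases i
  · exact h1
  · exact h2
  · exact h3

lemma av4321 {n : ℕ} (w : Equiv.Perm (Fin n)) : AvoidsPattern w pattern4321 ↔
    ∀ a b c d : Fin n, a < b → b < c → c < d → w d < w c → w c < w b → w b < w a → False := by
  constructor
  · intro h a b c d hab hbc hcd h1 h2 h3
    apply h
    apply contains4 w _ a b c d hab hbc hcd
    rw [Fin.strictMono_iff_lt_succ]
    intro i
    fin_cases i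
    · exact h1
    · exact h2
    · exact h3
  · rintro h ⟨j, hm, hj⟩
    exact h (j 0) (j 1) (j 2) (j 3) (hm (by decide)) (hm (by decide)) (hm (by decide))
      ((hj 3 2).2 (by decide)) ((hj 2 1).2 (by decide)) ((hj 1 0).2 (by decide))

lemma image_trip {n : ℕ} (w : Equiv.Perm (Fin n)) :
    (tripF w).image (fun t => (t.1, t.2.2)) = invF w \ coverPairs w := by
  ext ⟨a, c⟩
  rw [Finset.mem_image, Finset.mem_sdiff, mem_invF]
  simp only [coverPairs, Finset.mem_filter, Finset.mem_univ, true_and, mem_coverF]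
  constructor
  · rintro ⟨⟨a', b, c'⟩, ht, he⟩
    rw [mem_tripF] at ht
    simp only [Prod.mk.injEq] at he
    obtain ⟨rfl, rfl⟩ := he
    obtain ⟨h1, h2, h3, h4⟩ := ht
    refine ⟨⟨h1.trans h2, h3.trans h4⟩, ?_⟩
    rintro ⟨_, _, h⟩
    exact absurd (h b h1 h2 h3) (not_lt.2 h4.le)
  · rintro ⟨⟨h1, h2⟩, h⟩
    push Not at h
    obtain ⟨b, hb1, hb2, hb3, hb4⟩ := h h1 h2
    exact ⟨(a, b, c), (mem_tripF _ _ _ _).2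
      ⟨hb1, hb2, hb3, lt_of_le_of_ne hb4 (wne w hb1.ne')⟩, rfl⟩

lemma inj_trip {n : ℕ} (w : Equiv.Perm (Fin n)) (h2 : Av4231 w) :
    Set.InjOn (fun t : Fin n × Fin n × Fin n => (t.1, t.2.2)) (tripF w) ↔
      AvoidsPattern w pattern4321 := by
  rw [av4321]
  constructor
  · intro h a b c d hab hbc hcd h1 h2 h3
    have := @h (a, b, d) ((mem_tripF _ _ _ _).2 ⟨hab, hbc.trans hcd, h1.trans h2, h3⟩)
      (a, c, d) ((mem_tripF _ _ _ _).2 ⟨hab.trans hbc, hcd, h1, h2.trans h3⟩) rfl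
    simp only [Prod.mk.injEq] at this
    exact hbc.ne this.2.1
  · rintro h ⟨a, b, c⟩ ht ⟨a', b', c'⟩ ht' he
    rw [Finset.mem_coe, mem_tripF] at ht ht'
    simp only [Prod.mk.injEq] at he
    obtain ⟨rfl, rfl⟩ := he
    have aux : ∀ x y : Fin n, (a < x ∧ x < c ∧ w c < w x ∧ w x < w a) →
        (a < y ∧ y < c ∧ w c < w y ∧ w y < w a) → x < y → False := by
      rintro x y ⟨p1, p2, p3, p4⟩ ⟨q1, q2, q3, q4⟩ hxy
      rcases lt_or_gt_of_ne (wne w hxy.ne) with hh | hh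
      · exact h2 a x y c p1 hxy q2 p3 hh q4
      · exact h a x y c p1 hxy q2 q3 hh p4
    rcases lt_trichotomy b b' with hh | hh | hh
    · exact (aux b b' ht ht' hh).elim
    · rw [hh]
    · exact (aux b' b ht' ht hh).elim

/-- If `w` avoids 3412 and 4231, then `ℓ(w) - |supp(w)|` is at most the
number of occurrences of the pattern 321 in `w`, with equality iff `w` avoids 4321. -/
theorem stmt4 (n : ℕ) (w : Equiv.Perm (Fin n))
    (h1 : AvoidsPattern w pattern3412) (h2 : AvoidsPattern w pattern4231) :
    permLen n w - (permSupp n w).ncard ≤ numOcc w pattern321 ∧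
      (permLen n w - (permSupp n w).ncard = numOcc w pattern321 ↔
        AvoidsPattern w pattern4321) := by
  have a1 := av3412 w h1
  have a2 := av4231 w h2
  rw [permLen_eq, supp_card w a1 a2, numOcc_eq, ← inj_trip w a2, ← Finset.card_image_iff]
  have hsub : coverPairs w ⊆ invF w := by
    rintro ⟨a, b⟩ h
    simp only [coverPairs, Finset.mem_filter, Finset.mem_univ, true_and, mem_coverF] at h
    exact (mem_invF _ _ _).2 ⟨h.1, h.2.1⟩
  rw [← Finset.card_sdiff_of_subset hsub, ← image_trip]
  exact ⟨Finset.card_image_le, Iff.rfl⟩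
end

section
/- Let n ≥ 4 and let i be a positive integer with i + 2 ≤ n − 1. For the permutation w = s_{i+1} s_i s_{i+2} s_{i+1} in S_n, the Bruhat interval polytope Q_{e,w} ⊂ ℝ^n is combinatorially equivalent to the Bruhat interval polytope Q_{e,3412} ⊂ ℝ^4, where 3412 is the permutation 1↦3, 2↦4, 3↦1, 4↦2 in S_4. -/
theorem simpleT_of {n x : ℕ} (h : 1 ≤ x ∧ x < n) :
    simpleT n x = Equiv.swap ⟨x - 1, by omega⟩ ⟨x, h.2⟩ := by
  unfold simpleT; rw [dif_pos h]

/-- set of inversions -/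
def invSet (n : ℕ) (u : Equiv.Perm (Fin n)) : Finset (Fin n × Fin n) :=
  Finset.univ.filter fun p => p.1 < p.2 ∧ u p.2 < u p.1

theorem mem_invSet {n : ℕ} {u : Equiv.Perm (Fin n)} {p : Fin n × Fin n} :
    p ∈ invSet n u ↔ p.1 < p.2 ∧ u p.2 < u p.1 := by simp [invSet]

theorem swap_adj_lt {n x : ℕ} (h : 1 ≤ x ∧ x < n) {a b : Fin n}
    (hab : ¬ ((a : ℕ) = x - 1 ∧ (b : ℕ) = x)) (hba : ¬ ((b : ℕ) = x - 1 ∧ (a : ℕ) = x))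
    (hlt : simpleT n x a < simpleT n x b) : a < b := by
  rw [simpleT_of h, Equiv.swap_apply_def, Equiv.swap_apply_def] at hlt
  simp only [Fin.ext_iff] at hlt
  rw [Fin.lt_def] at hlt ⊢
  split_ifs at hlt <;> (try simp only at hlt) <;> omega

theorem invSet_simple {n x : ℕ} (h : 1 ≤ x ∧ x < n) (u : Equiv.Perm (Fin n)) :
    ∃ p : Fin n × Fin n, invSet n (simpleT n x * u) ⊆ insert p (invSet n u) ∧
      (((u p.1 : ℕ) = x - 1 ∧ (u p.2 : ℕ) = x) ∨ ((u p.2 : ℕ) = x - 1 ∧ (u p.1 : ℕ) = x)) := by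
  obtain ⟨y, hy⟩ : ∃ y : Fin n, (u y : ℕ) = x - 1 :=
    ⟨u.symm ⟨x - 1, by omega⟩, by simp⟩
  obtain ⟨z, hz⟩ : ∃ z : Fin n, (u z : ℕ) = x :=
    ⟨u.symm ⟨x, h.2⟩, by simp⟩
  have key : ∀ a b : Fin n, (a, b) ∈ invSet n (simpleT n x * u) → (a, b) ∉ invSet n u →
      (a = y ∧ b = z) ∨ (a = z ∧ b = y) := by
    intro a b h1 h2
    rw [mem_invSet] at h1 h2
    simp only [Equiv.Perm.mul_apply] at h1
    by_contra hc
    apply h2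
    refine ⟨h1.1, swap_adj_lt h ?_ ?_ h1.2⟩
    · rintro ⟨h3, h4⟩
      simp only at h3 h4
      exact hc (Or.inr ⟨u.injective (Fin.ext (by omega)), u.injective (Fin.ext (by omega))⟩)
    · rintro ⟨h3, h4⟩
      simp only at h3 h4
      exact hc (Or.inl ⟨u.injective (Fin.ext (by omega)), u.injective (Fin.ext (by omega))⟩)
  rcases lt_or_ge y z with hyz | hyz
  · refine ⟨(y, z), ?_, Or.inl ⟨hy, hz⟩⟩
    rintro ⟨a, b⟩ hp
    by_cases hq : (a, b) ∈ invSet n u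
    · exact Finset.mem_insert_of_mem hq
    · rcases key a b hp hq with ⟨rfl, rfl⟩ | ⟨rfl, rfl⟩
      · simp
      · exact absurd (mem_invSet.1 hp).1 (not_lt.2 hyz.le)
  · refine ⟨(z, y), ?_, Or.inr ⟨hy, hz⟩⟩
    rintro ⟨a, b⟩ hp
    by_cases hq : (a, b) ∈ invSet n u
    · exact Finset.mem_insert_of_mem hq
    · rcases key a b hp hq with ⟨rfl, rfl⟩ | ⟨rfl, rfl⟩
      · exact absurd (mem_invSet.1 hp).1 (not_lt.2 hyz)
      · simp

theorem simpleT_bad {n x : ℕ} (h : ¬ (1 ≤ x ∧ x < n)) : simpleT n x = 1 := by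
  unfold simpleT; rw [dif_neg h]

theorem inv_le_length (n : ℕ) (l : List ℕ) :
    (invSet n (l.map (simpleT n)).prod).card ≤ l.length := by
  induction l with
  | nil =>
    have : invSet n 1 = ∅ := by
      ext p; rw [mem_invSet]; simp; intro h; exact h.le
    simp [this]
  | cons x l ih =>
    simp only [List.map_cons, List.prod_cons, List.length_cons]
    by_cases h : 1 ≤ x ∧ x < n
    · obtain ⟨p, hp, -⟩ := invSet_simple h (l.map (simpleT n)).prod
      have := Finset.card_le_card hp
      have := Finset.card_insert_le p (invSet n (l.map (simpleT n)).prod)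
      omega
    · rw [simpleT_bad h, one_mul]; omega

/-- window -/
def inWin (n c : ℕ) (a : Fin n) : Prop := c ≤ (a : ℕ) ∧ (a : ℕ) < c + 4

theorem word_win {n c : ℕ} (l : List ℕ) (hl : ∀ x ∈ l, c + 1 ≤ x ∧ x ≤ c + 3)
    (a : Fin n) : inWin n c ((l.map (simpleT n)).prod a) ↔ inWin n c a := by
  induction l with
  | nil => simp
  | cons x l ih =>
    rw [← ih (fun y hy => hl y (List.mem_cons_of_mem _ hy))]
    simp only [List.map_cons, List.prod_cons, Equiv.Perm.mul_apply]
    generalize (l.map (simpleT n)).prod a = b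
    have hx := hl x List.mem_cons_self
    by_cases h : 1 ≤ x ∧ x < n
    · rw [simpleT_of h, Equiv.swap_apply_def]
      unfold inWin
      simp only [Fin.ext_iff]
      split_ifs <;> simp only <;> omega
    · rw [simpleT_bad h]; simp

theorem letters_win {n c : ℕ} (l : List ℕ)
    (hlen : l.length ≤ (invSet n (l.map (simpleT n)).prod).card)
    (hw : ∀ p ∈ invSet n (l.map (simpleT n)).prod, inWin n c p.1 ∧ inWin n c p.2) :
    ∀ x ∈ l, c + 1 ≤ x ∧ x ≤ c + 3 := by
  induction l with
  | nil => simp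
  | cons x l ih =>
    simp only [List.map_cons, List.prod_cons, List.length_cons] at hlen hw
    have hle := inv_le_length n l
    by_cases h : 1 ≤ x ∧ x < n
    · obtain ⟨p, hp, hpx⟩ := invSet_simple h (l.map (simpleT n)).prod
      have h1 := Finset.card_le_card hp
      have h2 := Finset.card_insert_le p (invSet n (l.map (simpleT n)).prod)
      have heq := Finset.eq_of_subset_of_card_le hp (by omega)
      rw [heq] at hw
      have hl := ih (by omega) (fun q hq => hw q (Finset.mem_insert_of_mem hq))
      have hpw := hw p (Finset.mem_insert_self _ _)
      rw [← word_win l hl p.1, ← word_win l hl p.2] at hpw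
      unfold inWin at hpw
      intro y hy
      rcases List.mem_cons.1 hy with rfl | hy
      · omega
      · exact hl y hy
    · rw [simpleT_bad h, one_mul] at hlen; omega

/-- embedding of the window -/
def winEmb (n c : ℕ) (h : c + 4 ≤ n) : Fin 4 ↪ Fin n :=
  ⟨fun k => ⟨c + k, by omega⟩, fun a b hab => by
    simp only [Fin.mk.injEq] at hab; exact Fin.ext (by omega)⟩

theorem winEmb_val {n c : ℕ} (h : c + 4 ≤ n) (k : Fin 4) : (winEmb n c h k : ℕ) = c + k := rfl

theorem mem_range_winEmb {n c : ℕ} (h : c + 4 ≤ n) (a : Fin n) :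
    a ∈ Set.range (winEmb n c h) ↔ inWin n c a := by
  constructor
  · rintro ⟨k, rfl⟩
    unfold inWin; rw [winEmb_val]; omega
  · rintro ⟨h1, h2⟩
    exact ⟨⟨a - c, by omega⟩, Fin.ext (by rw [winEmb_val]; simp only; omega)⟩

noncomputable def phi (n c : ℕ) (h : c + 4 ≤ n) : Equiv.Perm (Fin 4) →* Equiv.Perm (Fin n) :=
  Equiv.Perm.viaEmbeddingHom (winEmb n c h)

theorem phi_emb {n c : ℕ} (h : c + 4 ≤ n) (u : Equiv.Perm (Fin 4)) (k : Fin 4) :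
    phi n c h u (winEmb n c h k) = winEmb n c h (u k) :=
  Equiv.Perm.viaEmbedding_apply u (winEmb n c h) k

theorem phi_out {n c : ℕ} (h : c + 4 ≤ n) (u : Equiv.Perm (Fin 4)) (a : Fin n)
    (ha : ¬ inWin n c a) : phi n c h u a = a :=
  Equiv.Perm.viaEmbedding_apply_of_notMem u (winEmb n c h) a
    (by rwa [mem_range_winEmb])

theorem phi_inj {n c : ℕ} (h : c + 4 ≤ n) : Function.Injective (phi n c h) :=
  Equiv.Perm.viaEmbeddingHom_injective (winEmb n c h)

theorem phi_simple {n c : ℕ} (h : c + 4 ≤ n) {k : ℕ} (hk : 1 ≤ k ∧ k ≤ 3) :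
    phi n c h (simpleT 4 k) = simpleT n (c + k) := by
  ext a
  by_cases ha : inWin n c a
  · obtain ⟨b, rfl⟩ := (mem_range_winEmb h a).2 ha
    rw [phi_emb, simpleT_of (by omega : 1 ≤ k ∧ k < 4),
      simpleT_of (by omega : 1 ≤ c + k ∧ c + k < n), Equiv.swap_apply_def,
      Equiv.swap_apply_def]
    simp only [Fin.ext_iff, winEmb_val]
    split_ifs <;> simp only [winEmb_val] <;> omega
  · rw [phi_out h _ _ ha, simpleT_of (by omega : 1 ≤ c + k ∧ c + k < n), Equiv.swap_apply_def]
    unfold inWin at ha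
    simp only [Fin.ext_iff]
    split_ifs <;> simp only <;> omega

theorem phi_word {n c : ℕ} (h : c + 4 ≤ n) (l : List ℕ) (hl : ∀ x ∈ l, 1 ≤ x ∧ x ≤ 3) :
    phi n c h (l.map (simpleT 4)).prod = ((l.map (c + ·)).map (simpleT n)).prod := by
  induction l with
  | nil => simp
  | cons x l ih =>
    simp only [List.map_cons, List.prod_cons, map_mul]
    rw [ih (fun y hy => hl y (List.mem_cons_of_mem _ hy)), phi_simple h (hl x List.mem_cons_self)]

theorem inv_phi_win {n c : ℕ} (h : c + 4 ≤ n) (u : Equiv.Perm (Fin 4)) :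
    ∀ p ∈ invSet n (phi n c h u), inWin n c p.1 ∧ inWin n c p.2 := by
  rintro ⟨a, b⟩ hp
  rw [mem_invSet] at hp
  simp only at hp ⊢
  have hwin : ∀ a, inWin n c a → inWin n c (phi n c h u a) := by
    intro a ha
    obtain ⟨k, rfl⟩ := (mem_range_winEmb h a).2 ha
    rw [phi_emb, ← mem_range_winEmb h]; exact ⟨_, rfl⟩
  by_cases ha : inWin n c a <;> by_cases hb : inWin n c b
  · exact ⟨ha, hb⟩
  · have := hwin a ha
    rw [phi_out h u b hb] at hp
    unfold inWin at *; rw [Fin.lt_def, Fin.lt_def] at hp; omega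
  · have := hwin b hb
    rw [phi_out h u a ha] at hp
    unfold inWin at *; rw [Fin.lt_def, Fin.lt_def] at hp; omega
  · rw [phi_out h u a ha, phi_out h u b hb] at hp
    exact absurd hp.1 (not_lt.2 hp.2.le)

theorem inv_phi_ge {n c : ℕ} (h : c + 4 ≤ n) (u : Equiv.Perm (Fin 4)) :
    (invSet 4 u).card ≤ (invSet n (phi n c h u)).card := by
  apply Finset.card_le_card_of_injOn (fun p => (winEmb n c h p.1, winEmb n c h p.2))
  · intro p hp
    have hp := mem_invSet.1 hp
    apply mem_invSet.2
    simp only [phi_emb]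
    rw [Fin.lt_def, Fin.lt_def] at hp ⊢
    simp only [winEmb_val]; omega
  · rintro ⟨a, b⟩ - ⟨a', b'⟩ - hh
    simp only [Prod.mk.injEq, EmbeddingLike.apply_eq_iff_eq] at hh
    exact Prod.ext hh.1 hh.2

theorem s4_words : ∀ u : Equiv.Perm (Fin 4), ∃ l ∈ [1, 2, 1, 3, 2, 1].sublists,
    (l.map (simpleT 4)).prod = u ∧ l.length = (invSet 4 u).card := by
  decide +kernel

theorem permLen_le {n : ℕ} {l : List ℕ} {u : Equiv.Perm (Fin n)}
    (h : (l.map (simpleT n)).prod = u) : permLen n u ≤ l.length :=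
  Nat.sInf_le ⟨l, rfl, h⟩

theorem le_permLen {n : ℕ} {l : List ℕ} {u : Equiv.Perm (Fin n)}
    (h : (l.map (simpleT n)).prod = u) : (invSet n u).card ≤ permLen n u := by
  obtain ⟨l', h1, h2⟩ := Nat.sInf_mem
    (s := {m : ℕ | ∃ word : List ℕ, word.length = m ∧ (word.map (simpleT n)).prod = u})
    ⟨_, l, rfl, h⟩
  have := inv_le_length n l'
  rw [h2, h1] at this
  exact this

theorem s4_words' (u : Equiv.Perm (Fin 4)) : ∃ l : List ℕ, (∀ x ∈ l, 1 ≤ x ∧ x ≤ 3) ∧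
    (l.map (simpleT 4)).prod = u ∧ l.length = (invSet 4 u).card := by
  obtain ⟨l, hl, h1, h2⟩ := s4_words u
  refine ⟨l, fun x hx => ?_, h1, h2⟩
  have := (List.mem_sublists.1 hl).subset hx
  simp at this; omega

theorem len4 (u : Equiv.Perm (Fin 4)) : permLen 4 u = (invSet 4 u).card := by
  obtain ⟨l, -, h1, h2⟩ := s4_words' u
  exact le_antisymm (h2 ▸ permLen_le h1) (le_permLen h1)

theorem len_phi {n c : ℕ} (h : c + 4 ≤ n) (u : Equiv.Perm (Fin 4)) :
    permLen n (phi n c h u) = permLen 4 u ∧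
      permLen n (phi n c h u) = (invSet n (phi n c h u)).card := by
  obtain ⟨l, h0, h1, h2⟩ := s4_words' u
  have h3 := phi_word h l h0
  rw [h1] at h3
  have a1 := permLen_le h3.symm
  have a2 := le_permLen h3.symm
  have a3 := inv_phi_ge h u
  rw [len4]
  simp only [List.length_map] at a1
  omega

theorem red_letters {n c : ℕ} (h : c + 4 ≤ n) (u : Equiv.Perm (Fin 4)) (l : List ℕ)
    (hl : IsReducedWord n l (phi n c h u)) : ∀ x ∈ l, c + 1 ≤ x ∧ x ≤ c + 3 := by
  apply letters_win (n := n)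
  · rw [hl.1, hl.2, (len_phi h u).2]
  · rw [hl.1]; exact inv_phi_win h u

theorem red4_letters (u : Equiv.Perm (Fin 4)) (l : List ℕ)
    (hl : IsReducedWord 4 l u) : ∀ x ∈ l, 1 ≤ x ∧ x ≤ 3 := by
  have := letters_win (n := 4) (c := 0) l
    (by rw [hl.1, hl.2, len4]) (by intro p _; unfold inWin; omega)
  simpa using this

theorem red_shift {n c : ℕ} (h : c + 4 ≤ n) (u : Equiv.Perm (Fin 4)) (l : List ℕ)
    (hl : ∀ x ∈ l, 1 ≤ x ∧ x ≤ 3) :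
    IsReducedWord n (l.map (c + ·)) (phi n c h u) ↔ IsReducedWord 4 l u := by
  unfold IsReducedWord
  rw [← phi_word h l hl, (phi_inj h).eq_iff, (len_phi h u).1, List.length_map]

theorem unshift {c : ℕ} (l : List ℕ) (hl : ∀ x ∈ l, c + 1 ≤ x ∧ x ≤ c + 3) :
    ∃ l' : List ℕ, l = l'.map (c + ·) ∧ ∀ x ∈ l', 1 ≤ x ∧ x ≤ 3 := by
  refine ⟨l.map (· - c), ?_, ?_⟩
  · rw [List.map_map]
    conv_lhs => rw [← List.map_id l]
    apply List.map_congr_left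
    intro x hx
    have := hl x hx
    simp only [id, Function.comp]; omega
  · intro x hx
    obtain ⟨y, hy, rfl⟩ := List.mem_map.1 hx
    have := hl y hy
    omega

theorem bruhat_phi {n c : ℕ} (h : c + 4 ≤ n) (p : Equiv.Perm (Fin 4)) (u : Equiv.Perm (Fin n)) :
    bruhatLE n u (phi n c h p) ↔ ∃ u', u = phi n c h u' ∧ bruhatLE 4 u' p := by
  constructor
  · rintro ⟨lv, lw, hv, hw, hs⟩
    have hwl := red_letters h p lw hw
    obtain ⟨lw', rfl, hlw⟩ := unshift lw hwl
    obtain ⟨lv', rfl, hlv⟩ := unshift lv (fun x hx => hwl x (hs.subset hx))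
    have hu : u = phi n c h (lv'.map (simpleT 4)).prod := by rw [phi_word h lv' hlv]; exact hv.1.symm
    refine ⟨_, hu, lv', lw', ?_, (red_shift h p lw' hlw).1 hw, ?_⟩
    · rw [hu] at hv; exact (red_shift h _ lv' hlv).1 hv
    · have := hs.map (· - c)
      simpa [List.map_map, Function.comp_def] using this
  · rintro ⟨u', rfl, lv, lw, hv, hw, hs⟩
    exact ⟨lv.map (c + ·), lw.map (c + ·), (red_shift h _ _ (red4_letters _ _ hv)).2 hv,
      (red_shift h _ _ (red4_letters _ _ hw)).2 hw, hs.map _⟩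

theorem one_bruhat {n : ℕ} {u w : Equiv.Perm (Fin n)} (h : bruhatLE n u w) : bruhatLE n 1 u := by
  obtain ⟨lv, lw, hv, -⟩ := h
  refine ⟨[], lv, ⟨by simp, ?_⟩, hv, List.nil_sublist _⟩
  have := permLen_le (n := n) (l := []) (u := 1) (by simp)
  simp at this ⊢; omega

open Classical in
noncomputable def affT (n c : ℕ) (h : c + 4 ≤ n) : (Fin 4 → ℝ) →ᵃ[ℝ] (Fin n → ℝ) :=
  (Function.ExtendByZero.linearMap ℝ (winEmb n c h)).toAffineMap +
    AffineMap.const ℝ _ (fun j : Fin n => if inWin n c j then (c : ℝ) else (j : ℝ) + 1)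

theorem affT_emb {n c : ℕ} (h : c + 4 ≤ n) (x : Fin 4 → ℝ) (k : Fin 4) :
    affT n c h x (winEmb n c h k) = x k + c := by
  have : inWin n c (winEmb n c h k) := (mem_range_winEmb h _).1 ⟨k, rfl⟩
  simp [affT, this, (winEmb n c h).injective.extend_apply]

theorem affT_out {n c : ℕ} (h : c + 4 ≤ n) (x : Fin 4 → ℝ) (j : Fin n) (hj : ¬ inWin n c j) :
    affT n c h x j = j + 1 := by
  have : ¬ ∃ k, winEmb n c h k = j := fun hh => hj ((mem_range_winEmb h _).1 hh)
  simp [affT, hj, Function.extend_apply' _ _ _ this]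

theorem affT_inj {n c : ℕ} (h : c + 4 ≤ n) : Function.Injective (affT n c h) := by
  intro x y hxy
  ext k
  have := congrFun hxy (winEmb n c h k)
  rw [affT_emb, affT_emb] at this
  linarith

theorem affT_perm {n c : ℕ} (h : c + 4 ≤ n) (u : Equiv.Perm (Fin 4)) :
    affT n c h (permPoint 4 u) = permPoint n (phi n c h u) := by
  ext j
  by_cases hj : inWin n c j
  · obtain ⟨k, rfl⟩ := (mem_range_winEmb h j).2 hj
    rw [affT_emb]; unfold permPoint; rw [phi_emb, winEmb_val]; push_cast; ring
  · rw [affT_out h _ _ hj]; unfold permPoint; rw [phi_out h _ _ hj]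

theorem BIP_phi {n c : ℕ} (h : c + 4 ≤ n) (p : Equiv.Perm (Fin 4)) :
    BIP n 1 (phi n c h p) = affT n c h '' BIP 4 1 p := by
  unfold BIP
  rw [AffineMap.image_convexHull]
  congr 1
  ext x
  constructor
  · rintro ⟨u, -, hu, rfl⟩
    obtain ⟨u', rfl, hu'⟩ := (bruhat_phi h p u).1 hu
    exact ⟨_, ⟨u', one_bruhat hu', hu', rfl⟩, affT_perm h u'⟩
  · rintro ⟨_, ⟨u, -, hu, rfl⟩, rfl⟩
    have := (bruhat_phi h p _).2 ⟨u, rfl, hu⟩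
    exact ⟨_, one_bruhat this, this, affT_perm h u⟩

theorem face_image {E F : Type*} [AddCommGroup E] [Module ℝ E] [AddCommGroup F] [Module ℝ F]
    (T : E →ᵃ[ℝ] F) (hT : Function.Injective T) (P A : Set E) :
    IsFaceOf (T '' P) (T '' A) ↔ IsFaceOf P A := by
  constructor
  · rintro ⟨h1, h2⟩
    refine ⟨⟨?_, ?_⟩, ?_⟩
    · exact (Set.image_subset_image_iff hT).1 h1.subset
    · intro x hx y hy z hz hzo
      have := h1.left_mem_of_mem_openSegment (Set.mem_image_of_mem T hx) (Set.mem_image_of_mem T hy)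
        (Set.mem_image_of_mem T hz) (by rw [← image_openSegment]; exact ⟨z, hzo, rfl⟩)
      exact (hT.mem_set_image).1 this
    · have := h2.affine_preimage T
      rwa [Set.preimage_image_eq _ hT] at this
  · rintro ⟨h1, h2⟩
    refine ⟨⟨Set.image_mono h1.subset, ?_⟩, h2.affine_image T⟩
    rintro _ ⟨x, hx, rfl⟩ _ ⟨y, hy, rfl⟩ _ ⟨z, hz, rfl⟩ hzo
    rw [← image_openSegment, hT.mem_set_image] at hzo
    exact ⟨x, h1.left_mem_of_mem_openSegment hx hy hz hzo, rfl⟩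

theorem combEquiv_image {E F : Type*} [AddCommGroup E] [Module ℝ E] [AddCommGroup F] [Module ℝ F]
    (T : E →ᵃ[ℝ] F) (hT : Function.Injective T) (P : Set E) :
    CombEquiv (T '' P) P := by
  have him : ∀ A : {A : Set F // IsFaceOf (T '' P) A}, T '' (T ⁻¹' A.1) = A.1 := by
    intro A
    apply Set.image_preimage_eq_of_subset
    exact A.2.1.subset.trans (Set.image_subset_range _ _)
  refine ⟨⟨fun A => ⟨T ⁻¹' A.1, (face_image T hT P _).1 (by rw [him A]; exact A.2)⟩,
    fun B => ⟨T '' B.1, (face_image T hT P _).2 B.2⟩, fun A => Subtype.ext (him A),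
    fun B => Subtype.ext (Set.preimage_image_eq _ hT)⟩, ?_⟩
  intro A B
  simp only [Equiv.coe_fn_mk]
  conv_lhs => rw [← him A, ← him B]
  exact Set.image_subset_image_iff hT

theorem p3412_word : pattern3412 = simpleT 4 2 * simpleT 4 1 * simpleT 4 3 * simpleT 4 2 := by
  decide +kernel

/-- For `w = sᵢ₊₁ sᵢ sᵢ₊₂ sᵢ₊₁` in `S_n` (`n ≥ 4`, `1 ≤ i`,
`i + 2 ≤ n - 1`), the Bruhat interval polytope `Q_{e,w} ⊂ ℝⁿ` is combinatorially
equivalent to `Q_{e,3412} ⊂ ℝ⁴`. -/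
theorem stmt8 (n i : ℕ) (hn : 4 ≤ n) (hi : 1 ≤ i) (hin : i + 2 ≤ n - 1)
    (w : Equiv.Perm (Fin n))
    (hw : w = simpleT n (i + 1) * simpleT n i * simpleT n (i + 2) * simpleT n (i + 1)) :
    CombEquiv (BIP n 1 w) (BIP 4 1 pattern3412) := by
  obtain ⟨c, rfl⟩ : ∃ c, i = c + 1 := ⟨i - 1, by omega⟩
  have h : c + 4 ≤ n := by omega
  have hwp : w = phi n c h pattern3412 := by
    rw [hw, p3412_word]
    simp only [map_mul]
    rw [phi_simple h (by omega : 1 ≤ 2 ∧ 2 ≤ 3), phi_simple h (by omega : 1 ≤ 1 ∧ 1 ≤ 3),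
      phi_simple h (by omega : 1 ≤ 3 ∧ 3 ≤ 3)]
  rw [hwp, BIP_phi h]
  exact combEquiv_image _ (affT_inj h) _
end
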